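/- arXiv:2203.08987 — 5 statements merged into one kernel-verified Lean document; each statement's English description precedes it below -/
import Mathlib

section
/- Let $r_1, r_2, r_3, r_4, a_1, a_2, a_3, a_4, m$ be integers with $a_1, a_2, a_3, a_4, m$ positive, satisfying the four conditions: $a_1 - r_1 - m\lceil (a_1-2r_1)/(2m) \rceil = a_3 - r_3 - m\lceil (a_3-2r_3)/(2m) \rceil$; $a_1 + r_1 - m\lceil (a_1+2r_1)/(2m) \rceil = a_4 - r_4 - m\lceil (a_4-2r_4)/(2m) \rceil$; $a_2 - r_2 - m\lceil (a_2-2r_2)/(2m) \rceil = a_4 + r_4 - m\lceil (a_4+2r_4)/(2m) \rceil$; and $a_2 + r_2 - m\lceil (a_2+2r_2)/(2m) \rceil = a_3 + r_3 - m\lceil (a_3+2r_3)/(2m) \rceil$ (where the ceilings are of rational numbers). Then for every integer $n \geq 0$, $N^+(r_1, m, 2mn + a_1) + N^+(r_2, m, 2mn + a_2) = N^+(r_3, m, 2mn + a_3) + N^+(r_4, m, 2mn + a_4)$. -/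
/-- The Dyson rank of a partition: its largest part minus its number of parts. -/
def Nat.Partition.rank {n : ℕ} (l : n.Partition) : ℤ :=
  (l.parts.sup : ℤ) - l.parts.card

/-- `N⁺ r m n`: the number of partitions of `n` whose rank is congruent to `r` modulo `m`
and has absolute value at least `n / 2` (`0` when `n` is not a positive integer). -/
noncomputable def rankCountPlus (r m n : ℤ) : ℕ :=
  if 0 < n then
    Nat.card {l : Nat.Partition n.toNat //
      l.rank ≡ r [ZMOD m] ∧ (n : ℚ) / 2 ≤ |(l.rank : ℚ)|}
  else 0

namespace YoungDiagram

theorem sum_rowLens (μ : YoungDiagram) : μ.rowLens.sum = μ.card := by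
  have hmaps : ∀ c ∈ μ.cells, c.1 ∈ Finset.range (μ.colLen 0) := by
    rintro ⟨i, j⟩ hc
    rw [Finset.mem_range, ← mem_iff_lt_colLen]
    exact μ.up_left_mem le_rfl j.zero_le hc
  rw [YoungDiagram.card, Finset.card_eq_sum_card_fiberwise hmaps, rowLens,
    ← List.sum_toFinset _ List.nodup_range, List.toFinset_range]
  exact Finset.sum_congr rfl fun i _ ↦ μ.rowLen_eq_card

theorem sup_rowLens (μ : YoungDiagram) : (μ.rowLens : Multiset ℕ).sup = μ.rowLen 0 := by
  apply le_antisymm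
  · refine Multiset.sup_le.2 fun x hx ↦ ?_
    obtain ⟨i, -, rfl⟩ := List.mem_map.1 (Multiset.mem_coe.1 hx)
    exact μ.rowLen_anti 0 i i.zero_le
  · rcases Nat.eq_zero_or_pos (μ.rowLen 0) with h | h
    · simp [h]
    · refine Multiset.le_sup (Multiset.mem_coe.2 (List.mem_map.2 ⟨0, ?_, rfl⟩))
      rwa [List.mem_range, ← mem_iff_lt_colLen, mem_iff_lt_rowLen]

theorem card_transpose (μ : YoungDiagram) : μ.transpose.card = μ.card := by
  simp [YoungDiagram.card, transpose]

end YoungDiagram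

namespace Nat.Partition

variable {n : ℕ}

/-- The Young diagram whose row lengths are the parts of a partition. -/
def youngDiagram (l : n.Partition) : YoungDiagram :=
  YoungDiagram.ofRowLens (l.parts.sort (· ≥ ·)) (l.parts.pairwise_sort _).sortedGE

theorem rowLens_youngDiagram (l : n.Partition) :
    l.youngDiagram.rowLens = l.parts.sort (· ≥ ·) :=
  YoungDiagram.rowLens_ofRowLens_eq_self fun _ hx ↦ l.parts_pos ((Multiset.mem_sort _).1 hx)

theorem coe_rowLens_youngDiagram (l : n.Partition) :
    (l.youngDiagram.rowLens : Multiset ℕ) = l.parts := by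
  rw [rowLens_youngDiagram, Multiset.sort_eq]

theorem card_youngDiagram (l : n.Partition) : l.youngDiagram.card = n := by
  rw [← YoungDiagram.sum_rowLens, ← Multiset.sum_coe, coe_rowLens_youngDiagram, l.parts_sum]

/-- The conjugate partition, whose Young diagram is the transpose. -/
def conj (l : n.Partition) : n.Partition where
  parts := l.youngDiagram.transpose.rowLens
  parts_pos hi := YoungDiagram.pos_of_mem_rowLens _ _ (Multiset.mem_coe.1 hi)
  parts_sum := by
    rw [Multiset.sum_coe, YoungDiagram.sum_rowLens, YoungDiagram.card_transpose, card_youngDiagram]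

theorem youngDiagram_conj (l : n.Partition) : l.conj.youngDiagram = l.youngDiagram.transpose := by
  apply YoungDiagram.equivListRowLens.injective
  apply Subtype.ext
  change l.conj.youngDiagram.rowLens = l.youngDiagram.transpose.rowLens
  refine List.Perm.eq_of_sortedGE ?_ ?_ (Multiset.coe_eq_coe.1 l.conj.coe_rowLens_youngDiagram)
  · exact YoungDiagram.rowLens_sorted _
  · exact YoungDiagram.rowLens_sorted _

theorem conj_conj (l : n.Partition) : l.conj.conj = l := by
  apply Nat.Partition.ext
  rw [← coe_rowLens_youngDiagram, youngDiagram_conj, youngDiagram_conj,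
    YoungDiagram.transpose_transpose, coe_rowLens_youngDiagram]

theorem rank_eq_rowLen_sub_colLen (l : n.Partition) :
    l.rank = (l.youngDiagram.rowLen 0 : ℤ) - l.youngDiagram.colLen 0 := by
  rw [rank, ← coe_rowLens_youngDiagram, YoungDiagram.sup_rowLens, Multiset.coe_card,
    YoungDiagram.length_rowLens]

theorem rank_conj (l : n.Partition) : l.conj.rank = -l.rank := by
  simp [rank_eq_rowLen_sub_colLen, youngDiagram_conj]

theorem sup_mem_parts (l : n.Partition) (hn : 0 < n) : l.parts.sup ∈ l.parts := by
  have hne : l.parts.toFinset.Nonempty := by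
    rw [Multiset.toFinset_nonempty]
    intro h
    have := l.parts_sum
    simp [h] at this
    omega
  obtain ⟨x, hx, hs⟩ := Finset.exists_mem_eq_sup _ hne id
  rw [Finset.sup_def, Multiset.map_id, Multiset.toFinset_val, Multiset.sup_dedup] at hs
  rw [hs]
  exact Multiset.mem_toFinset.1 hx

/-- Remove the largest part and increase every other part by one. -/
def raiseTail (l : n.Partition) : Multiset ℕ :=
  (l.parts.erase l.parts.sup).map (· + 1)

theorem two_le_of_mem_raiseTail (l : n.Partition) {x : ℕ} (hx : x ∈ l.raiseTail) : 2 ≤ x := by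
  obtain ⟨y, hy, rfl⟩ := Multiset.mem_map.1 hx
  have := l.parts_pos (Multiset.mem_of_mem_erase hy)
  omega

theorem sum_raiseTail (l : n.Partition) (hn : 0 < n) :
    (l.raiseTail.sum : ℤ) = n - 1 - l.rank := by
  have hcons := Multiset.cons_erase (l.sup_mem_parts hn)
  have hsum := congrArg Multiset.sum hcons
  have hcard := congrArg Multiset.card hcons
  rw [Multiset.sum_cons, l.parts_sum] at hsum
  rw [Multiset.card_cons] at hcard
  simp only [raiseTail, Multiset.sum_map_add, Multiset.map_id', Multiset.map_const',
    Multiset.sum_replicate, smul_eq_mul, mul_one, rank]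
  omega

theorem raiseTail_injective (hn : 0 < n) : Function.Injective (raiseTail (n := n)) := by
  intro l l' h
  have ht : l.parts.erase l.parts.sup = l'.parts.erase l'.parts.sup :=
    Multiset.map_injective (add_left_injective 1) h
  have hc := Multiset.cons_erase (l.sup_mem_parts hn)
  have hc' := Multiset.cons_erase (l'.sup_mem_parts hn)
  have hs := congrArg Multiset.sum hc
  have hs' := congrArg Multiset.sum hc'
  rw [Multiset.sum_cons, parts_sum] at hs hs'
  rw [ht] at hs
  apply Nat.Partition.ext
  rw [← hc, ← hc', ht, show l.parts.sup = l'.parts.sup by omega]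

theorem exists_raiseTail_eq {s : Multiset ℕ} (hs : ∀ x ∈ s, 2 ≤ x) (hn : 2 * s.sum + 2 ≤ n) :
    ∃ l : n.Partition, l.raiseTail = s := by
  obtain ⟨t, rfl⟩ : ∃ t : Multiset ℕ, t.map (· + 1) = s := by
    refine ⟨s.map (· - 1), ?_⟩
    rw [Multiset.map_map]
    conv_rhs => rw [← Multiset.map_id s]
    refine Multiset.map_congr rfl fun x hx ↦ ?_
    have := hs x hx
    simp only [Function.comp_apply, id]
    omega
  have hle : 2 * t.sum + 2 ≤ n := by
    simp only [Multiset.sum_map_add, Multiset.map_id'] at hn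
    omega
  have hsup : ((n - t.sum) ::ₘ t).sup = n - t.sum := by
    rw [Multiset.sup_cons, sup_eq_left, Multiset.sup_le]
    intro x hx
    have := Multiset.le_sum_of_mem hx
    omega
  refine ⟨⟨(n - t.sum) ::ₘ t, fun {i} hi ↦ ?_, ?_⟩, ?_⟩
  · rcases Multiset.mem_cons.1 hi with rfl | hi
    · omega
    · have := hs (i + 1) (Multiset.mem_map_of_mem _ hi)
      omega
  · rw [Multiset.sum_cons]
    omega
  · simp only [raiseTail, hsup, Multiset.erase_cons_head]

theorem ncard_rank_large (r m : ℤ) (hn : 0 < n) :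
    {l : n.Partition | l.rank ≡ r [ZMOD m] ∧ (n : ℤ) ≤ 2 * l.rank}.ncard =
      {s : Multiset ℕ | (∀ x ∈ s, 2 ≤ x) ∧ (s.sum : ℤ) ≡ n - 1 - r [ZMOD m] ∧
        2 * (s.sum : ℤ) + 2 ≤ n}.ncard := by
  refine Set.ncard_congr (fun l _ ↦ l.raiseTail) ?_ (fun _ _ _ _ h ↦ raiseTail_injective hn h) ?_
  · rintro l ⟨hr, hl⟩
    refine ⟨fun _ ↦ l.two_le_of_mem_raiseTail, ?_, ?_⟩
    · rw [l.sum_raiseTail hn]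
      exact hr.sub_left _
    · rw [l.sum_raiseTail hn]
      omega
  · rintro s ⟨hs, hr, hl⟩
    obtain ⟨l, rfl⟩ := exists_raiseTail_eq (n := n) hs (by omega)
    rw [l.sum_raiseTail hn] at hr hl
    refine ⟨l, ⟨?_, by omega⟩, rfl⟩
    simpa using hr.sub_left ((n : ℤ) - 1)

theorem ncard_rank_small (r m : ℤ) :
    {l : n.Partition | l.rank ≡ r [ZMOD m] ∧ (n : ℤ) ≤ 2 * -l.rank}.ncard =
      {l : n.Partition | l.rank ≡ -r [ZMOD m] ∧ (n : ℤ) ≤ 2 * l.rank}.ncard := by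
  refine Set.ncard_congr (fun l _ ↦ l.conj) ?_
    (fun _ _ _ _ h ↦ Function.LeftInverse.injective conj_conj h) ?_
  · rintro l ⟨hr, hl⟩
    simp only [Set.mem_ofPred_eq, rank_conj]
    exact ⟨hr.neg, hl⟩
  · rintro l ⟨hr, hl⟩
    refine ⟨l.conj, ⟨?_, ?_⟩, l.conj_conj⟩
    · rw [rank_conj]
      simpa using hr.neg
    · rwa [rank_conj, neg_neg]

end Nat.Partition

theorem rankCountPlus_eq_add_ncard (r m n : ℤ) (hn : 0 < n) :
    rankCountPlus r m n =
      {s : Multiset ℕ | (∀ x ∈ s, 2 ≤ x) ∧ (s.sum : ℤ) ≡ n - 1 - r [ZMOD m] ∧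
        2 * (s.sum : ℤ) + 2 ≤ n}.ncard +
      {s : Multiset ℕ | (∀ x ∈ s, 2 ≤ x) ∧ (s.sum : ℤ) ≡ n - 1 - (-r) [ZMOD m] ∧
        2 * (s.sum : ℤ) + 2 ≤ n}.ncard := by
  lift n to ℕ using hn.le
  rw [Nat.cast_pos] at hn
  rw [rankCountPlus, if_pos (by exact_mod_cast hn), Int.toNat_natCast,
    ← Nat.Partition.ncard_rank_large r m hn, ← Nat.Partition.ncard_rank_large (-r) m hn,
    ← Nat.Partition.ncard_rank_small, ← Set.ncard_union_eq]
  · rw [← Set.ofPred_or]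
    refine congrArg Set.ncard (Set.ext fun l ↦ ?_)
    have habs : (((n : ℤ) : ℚ) / 2 ≤ |(l.rank : ℚ)|) ↔
        (n : ℤ) ≤ 2 * l.rank ∨ (n : ℤ) ≤ 2 * -l.rank := by
      rw [div_le_iff₀' two_pos, ← Int.cast_abs]
      norm_cast
      rw [← abs_two, ← abs_mul, abs_two, le_abs, mul_neg]
    exact (and_congr_right fun _ ↦ habs).trans and_or_left
  · rw [Set.disjoint_left]
    rintro l ⟨-, hpos⟩ ⟨-, hneg⟩
    omega

/-- The number of partitions without ones whose size is congruent to `e - 1` modulo `m` and is less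
than `m * n + e`. -/
noncomputable def noOnesCount (m n e : ℤ) : ℕ :=
  {s : Multiset ℕ | (∀ x ∈ s, 2 ≤ x) ∧ (s.sum : ℤ) ≡ e - 1 [ZMOD m] ∧
    (s.sum : ℤ) + 1 ≤ m * n + e}.ncard

theorem ncard_eq_noOnesCount (a r m n : ℤ) (hm : 0 < m) :
    {s : Multiset ℕ | (∀ x ∈ s, 2 ≤ x) ∧ (s.sum : ℤ) ≡ 2 * m * n + a - 1 - r [ZMOD m] ∧
        2 * (s.sum : ℤ) + 2 ≤ 2 * m * n + a}.ncard =
      noOnesCount m n (a - r - m * ⌈((a : ℚ) - 2 * r) / (2 * m)⌉) := by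
  have hm' : (0 : ℚ) < 2 * m := by positivity
  have hle := Int.le_ceil (((a : ℚ) - 2 * r) / (2 * m))
  have hlt := Int.ceil_lt_add_one (((a : ℚ) - 2 * r) / (2 * m))
  generalize ⌈((a : ℚ) - 2 * r) / (2 * m)⌉ = c at hle hlt ⊢
  rw [div_le_iff₀ hm'] at hle
  rw [← sub_lt_iff_lt_add, lt_div_iff₀ hm'] at hlt
  norm_cast at hle hlt
  refine congrArg Set.ncard (Set.ext fun s ↦ and_congr_right fun _ ↦ ?_)
  have hmod : 2 * m * n + a - 1 - r ≡ a - r - m * c - 1 [ZMOD m] :=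
    Int.modEq_iff_dvd.2 ⟨-c - 2 * n, by ring⟩
  constructor
  · rintro ⟨hs, hl⟩
    have hs' := hs.trans hmod
    refine ⟨hs', ?_⟩
    obtain ⟨k, hk⟩ := Int.modEq_iff_dvd.1 hs'
    have : -n < k + 1 := by
      by_contra! hcon
      nlinarith
    nlinarith
  · rintro ⟨hs, hl⟩
    exact ⟨hs.trans hmod.symm, by linarith⟩

theorem rankCountPlus_two_mul_mul_add {m n a r : ℤ} (hm : 0 < m) (hn : 0 ≤ n) (ha : 0 < a) :
    rankCountPlus r m (2 * m * n + a) =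
      noOnesCount m n (a - r - m * ⌈((a : ℚ) - 2 * r) / (2 * m)⌉) +
      noOnesCount m n (a + r - m * ⌈((a : ℚ) + 2 * r) / (2 * m)⌉) := by
  rw [rankCountPlus_eq_add_ncard r m _ (by positivity), ncard_eq_noOnesCount a r m n hm,
    ncard_eq_noOnesCount a (-r) m n hm]
  simp only [Int.cast_neg, mul_neg, sub_neg_eq_add]

theorem rankCountPlus_identity
    (r₁ r₂ r₃ r₄ a₁ a₂ a₃ a₄ m : ℤ)
    (ha₁ : 0 < a₁) (ha₂ : 0 < a₂) (ha₃ : 0 < a₃) (ha₄ : 0 < a₄) (hm : 0 < m)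
    (h1 : a₁ - r₁ - m * ⌈((a₁ : ℚ) - 2 * r₁) / (2 * m)⌉
        = a₃ - r₃ - m * ⌈((a₃ : ℚ) - 2 * r₃) / (2 * m)⌉)
    (h2 : a₁ + r₁ - m * ⌈((a₁ : ℚ) + 2 * r₁) / (2 * m)⌉
        = a₄ - r₄ - m * ⌈((a₄ : ℚ) - 2 * r₄) / (2 * m)⌉)
    (h3 : a₂ - r₂ - m * ⌈((a₂ : ℚ) - 2 * r₂) / (2 * m)⌉
        = a₄ + r₄ - m * ⌈((a₄ : ℚ) + 2 * r₄) / (2 * m)⌉)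
    (h4 : a₂ + r₂ - m * ⌈((a₂ : ℚ) + 2 * r₂) / (2 * m)⌉
        = a₃ + r₃ - m * ⌈((a₃ : ℚ) + 2 * r₃) / (2 * m)⌉) :
    ∀ n : ℤ, 0 ≤ n →
      rankCountPlus r₁ m (2 * m * n + a₁) + rankCountPlus r₂ m (2 * m * n + a₂)
        = rankCountPlus r₃ m (2 * m * n + a₃) + rankCountPlus r₄ m (2 * m * n + a₄) := by
  intro n hn
  rw [rankCountPlus_two_mul_mul_add hm hn ha₁, rankCountPlus_two_mul_mul_add hm hn ha₂,
    rankCountPlus_two_mul_mul_add hm hn ha₃, rankCountPlus_two_mul_mul_add hm hn ha₄,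
    h1, h2, h3, h4]
  ring
end

section
/- For all integers $m$ and $n$, the number $N(m,n)$ of partitions of $n$ with rank equal to $m$ satisfies $N(m,n) \leq g(n - |m|)$, where $g(k)$ denotes the number of partitions of $k$ for which the number of parts occurs as a part. -/
/-- `N m n`: the number of partitions of `n` with rank exactly `m`
(`0` when `n` is not a positive integer). -/
noncomputable def rankCount (m n : ℤ) : ℕ :=
  if 0 < n then Nat.card {l : Nat.Partition n.toNat // l.rank = m} else 0

/-- `g k`: the number of partitions of `k` for which the number of parts occurs as a part
(`0` when `k` is not a positive integer). -/
noncomputable def g (k : ℤ) : ℕ :=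
  if 0 < k then
    Nat.card {l : Nat.Partition k.toNat // (l.parts.card : ℕ) ∈ l.parts}
  else 0

theorem Multiset.sup_mem_of_ne_zero {α : Type*} [LinearOrder α] [OrderBot α] {s : Multiset α}
    (hs : s ≠ 0) : s.sup ∈ s := by
  induction s using Multiset.induction_on with
  | empty => exact absurd rfl hs
  | cons a s ih =>
    rw [Multiset.sup_cons]
    rcases eq_or_ne s 0 with rfl | h
    · simp
    · rcases max_choice a s.sup with h' | h' <;> rw [h']
      · exact Multiset.mem_cons_self _ _
      · exact Multiset.mem_cons_of_mem (ih h)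

theorem Multiset.sum_range_countP_lt (s : Multiset ℕ) {N : ℕ} (hN : ∀ x ∈ s, x ≤ N) :
    ∑ j ∈ Finset.range N, s.countP (j < ·) = s.sum := by
  induction s using Multiset.induction_on with
  | empty => simp
  | cons a s ih =>
    simp only [Multiset.countP_cons, Finset.sum_add_distrib, Multiset.sum_cons]
    rw [ih fun x hx => hN x (Multiset.mem_cons_of_mem hx), ← Finset.card_filter]
    have ha : a ≤ N := hN a (Multiset.mem_cons_self _ _)
    have : (Finset.range N).filter (· < a) = Finset.range a := by
      ext j
      simp only [Finset.mem_filter, Finset.mem_range]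
      omega
    rw [this, Finset.card_range, add_comm]

theorem Multiset.countP_lt_eq_count_add (s : Multiset ℕ) (j : ℕ) :
    s.countP (j < ·) = s.count (j + 1) + s.countP (j + 1 < ·) := by
  induction s using Multiset.induction_on with
  | empty => simp
  | cons a s ih =>
    simp only [Multiset.countP_cons, Multiset.count_cons, ih]
    split_ifs <;> omega

theorem Nat.Partition.parts_ne_zero {n : ℕ} (hn : 0 < n) (l : n.Partition) : l.parts ≠ 0 := by
  intro h
  have := l.parts_sum
  simp only [h, Multiset.sum_zero] at this
  omega

/-- The conjugate partition, whose parts are the column lengths of the Young diagram. -/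
def Nat.Partition.conj_s1 {n : ℕ} (l : n.Partition) : n.Partition where
  parts := (Multiset.range l.parts.sup).map fun j => l.parts.countP (j < ·)
  parts_pos := by
    intro i hi
    obtain ⟨j, hj, rfl⟩ := Multiset.mem_map.1 hi
    rw [Multiset.mem_range] at hj
    refine Multiset.countP_pos.2 ⟨l.parts.sup, Multiset.sup_mem_of_ne_zero ?_, hj⟩
    intro h
    simp [h] at hj
  parts_sum := by
    refine Eq.trans ?_ l.parts_sum
    exact l.parts.sum_range_countP_lt fun x hx => Multiset.le_sup hx

theorem Nat.Partition.conj_parts {n : ℕ} (l : n.Partition) :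
    l.conj_s1.parts = (Multiset.range l.parts.sup).map fun j => l.parts.countP (j < ·) :=
  rfl

theorem Nat.Partition.card_conj_parts {n : ℕ} (l : n.Partition) :
    l.conj_s1.parts.card = l.parts.sup := by
  simp [conj_parts]

theorem Nat.Partition.sup_conj_parts {n : ℕ} (hn : 0 < n) (l : n.Partition) :
    l.conj_s1.parts.sup = l.parts.card := by
  rw [conj_parts]
  apply le_antisymm
  · refine Multiset.sup_le.2 fun x hx => ?_
    obtain ⟨j, -, rfl⟩ := Multiset.mem_map.1 hx
    exact Multiset.countP_le_card _ _
  · refine Multiset.le_sup (Multiset.mem_map.2 ⟨0, ?_, ?_⟩)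
    · exact Multiset.mem_range.2
        (l.parts_pos (Multiset.sup_mem_of_ne_zero (l.parts_ne_zero hn)))
    · exact Multiset.countP_eq_card.2 fun x hx => l.parts_pos hx

theorem Nat.Partition.rank_conj_s1 {n : ℕ} (hn : 0 < n) (l : n.Partition) :
    l.conj_s1.rank = -l.rank := by
  simp only [rank, card_conj_parts, sup_conj_parts hn]
  ring

/-- Comparing the number of parts of the conjugate exceeding `i` with `j` amounts to comparing
`i` with the number of parts exceeding `j`. -/
theorem Nat.Partition.lt_countP_conj_parts {n : ℕ} (l : n.Partition) (i j : ℕ) :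
    j < l.conj_s1.parts.countP (i < ·) ↔ i < l.parts.countP (j < ·) := by
  have hanti : ∀ {a b : ℕ}, a ≤ b → l.parts.countP (b < ·) ≤ l.parts.countP (a < ·) := by
    intro a b hab
    simp only [Multiset.countP_eq_card_filter]
    exact Multiset.card_le_card (Multiset.monotone_filter_right _ fun _ h => hab.trans_lt h)
  have hcount : l.conj_s1.parts.countP (i < ·) =
      ((Finset.range l.parts.sup).filter fun k => i < l.parts.countP (k < ·)).card := by
    rw [conj_parts, Multiset.countP_map]
    rfl
  rw [hcount]
  constructor
  · intro h
    by_contra hj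
    rw [← Finset.card_range j] at h
    refine h.not_ge (Finset.card_le_card fun k hk => ?_)
    rw [Finset.mem_range]
    by_contra hjk
    exact hj ((Finset.mem_filter.1 hk).2.trans_le (hanti (not_lt.1 hjk)))
  · intro h
    have hsup : j < l.parts.sup := by
      obtain ⟨x, hx, hjx⟩ := Multiset.countP_pos.1 (Nat.zero_lt_of_lt h)
      exact hjx.trans_le (Multiset.le_sup hx)
    rw [← Nat.succ_le_iff, ← Finset.card_range j.succ]
    refine Finset.card_le_card fun k hk => ?_
    have hkj : k ≤ j := Nat.lt_succ_iff.1 (Finset.mem_range.1 hk)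
    exact Finset.mem_filter.2
      ⟨Finset.mem_range.2 (hkj.trans_lt hsup), h.trans_le (hanti hkj)⟩

theorem Nat.Partition.conj_injective {n : ℕ} :
    Function.Injective (Nat.Partition.conj_s1 : n.Partition → n.Partition) := by
  intro l l' h
  have key : ∀ j, l.parts.countP (j < ·) = l'.parts.countP (j < ·) := fun j =>
    eq_of_forall_lt_iff fun i => by
      rw [← l.lt_countP_conj_parts, ← l'.lt_countP_conj_parts, h]
  ext1
  ext a
  cases a with
  | zero =>
    rw [Multiset.count_eq_zero_of_notMem fun h => (l.parts_pos h).false,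
      Multiset.count_eq_zero_of_notMem fun h => (l'.parts_pos h).false]
  | succ j =>
    have h₁ := l.parts.countP_lt_eq_count_add j
    have h₂ := l'.parts.countP_lt_eq_count_add j
    rw [key j, key (j + 1)] at h₁
    omega

theorem rankCount_le_rankCount_neg (m n : ℤ) : rankCount m n ≤ rankCount (-m) n := by
  unfold rankCount
  split_ifs with hn
  · refine Nat.card_le_card_of_injective
      (fun l => ⟨l.1.conj_s1, by rw [Nat.Partition.rank_conj_s1 (by omega), l.2]⟩) ?_
    intro l l' h
    exact Subtype.ext (Nat.Partition.conj_injective (Subtype.ext_iff.1 h))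
  · rfl

/-- Lowering the largest part of a partition until it equals the number of parts. -/
def Nat.Partition.lowerSup {n : ℕ} (hn : 0 < n) (m : ℕ) (l : n.Partition) (hl : l.rank = m) :
    (n - m).Partition where
  parts := l.parts.card ::ₘ l.parts.erase l.parts.sup
  parts_pos := by
    intro i hi
    rcases Multiset.mem_cons.1 hi with rfl | hi
    · exact Multiset.card_pos.2 (l.parts_ne_zero hn)
    · exact l.parts_pos (Multiset.mem_of_mem_erase hi)
  parts_sum := by
    have h := Multiset.sum_erase (Multiset.sup_mem_of_ne_zero (l.parts_ne_zero hn))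
    rw [l.parts_sum] at h
    rw [Multiset.sum_cons]
    unfold rank at hl
    omega

theorem Nat.Partition.card_lowerSup_parts {n : ℕ} (hn : 0 < n) (m : ℕ) (l : n.Partition)
    (hl : l.rank = m) : (l.lowerSup hn m hl).parts.card = l.parts.card := by
  rw [lowerSup, Multiset.card_cons,
    Multiset.card_erase_add_one (Multiset.sup_mem_of_ne_zero (l.parts_ne_zero hn))]

theorem Nat.Partition.lowerSup_injective {n : ℕ} (hn : 0 < n) (m : ℕ) {l l' : n.Partition}
    (hl : l.rank = m) (hl' : l'.rank = m) (h : l.lowerSup hn m hl = l'.lowerSup hn m hl') :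
    l = l' := by
  have hcard : l.parts.card = l'.parts.card := by
    rw [← card_lowerSup_parts hn m l hl, h, card_lowerSup_parts]
  have hparts : l.parts.card ::ₘ l.parts.erase l.parts.sup =
      l'.parts.card ::ₘ l'.parts.erase l'.parts.sup := congrArg parts h
  rw [hcard, Multiset.cons_inj_right] at hparts
  have hsup : l.parts.sup = l'.parts.sup := by
    unfold rank at hl hl'
    omega
  ext1
  rw [← Multiset.cons_erase (Multiset.sup_mem_of_ne_zero (l.parts_ne_zero hn)), hparts, hsup,
    Multiset.cons_erase (Multiset.sup_mem_of_ne_zero (l'.parts_ne_zero hn))]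

theorem rankCount_natCast_le_g (m : ℕ) (n : ℤ) : rankCount m n ≤ g (n - m) := by
  by_cases hn : 0 < n
  swap
  · simp [rankCount, hn]
  rw [rankCount, if_pos hn]
  rcases isEmpty_or_nonempty {l : Nat.Partition n.toNat // l.rank = m} with _ | ⟨l, hl⟩
  · simp
  have hn' : 0 < n.toNat := by omega
  have hm : 0 < n - m := by
    have hsup := Multiset.sup_mem_of_ne_zero (l.parts_ne_zero hn')
    have hle := Multiset.le_sum_of_mem hsup
    have hcard := Multiset.card_pos.2 (l.parts_ne_zero hn')
    rw [l.parts_sum] at hle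
    unfold Nat.Partition.rank at hl
    omega
  rw [g, if_pos hm, show (n - m).toNat = n.toNat - m by omega]
  refine Nat.card_le_card_of_injective (fun l => ⟨l.1.lowerSup hn' m l.2, ?_⟩) ?_
  · rw [Nat.Partition.card_lowerSup_parts]
    exact Multiset.mem_cons_self _ _
  · intro l l' h
    exact Subtype.ext (Nat.Partition.lowerSup_injective hn' m l.2 l'.2 (Subtype.ext_iff.1 h))

theorem rankCount_le_g (m n : ℤ) : rankCount m n ≤ g (n - |m|) := by
  have h : rankCount m n ≤ rankCount |m| n := by
    rcases abs_choice m with h | h <;> rw [h]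
    exact rankCount_le_rankCount_neg m n
  rw [← Int.natCast_natAbs] at h ⊢
  exact h.trans (rankCount_natCast_le_g _ n)
end

section
/- For every integer $k \geq 1$, the number $g(k)$ of partitions of $k$ for which the number of parts occurs as a part equals $p(k-1) - p(k-2)$, where $p$ is the partition function with the convention $p(0) = 1$ and $p(x) = 0$ for negative $x$. -/
/-- The partition function `p`, extended to the integers by `p(x) = 0` when `x` is not a
non-negative integer (and `p 0 = 1`, counting the empty partition). -/
noncomputable def partitionFn (n : ℤ) : ℕ :=
  if 0 ≤ n then Nat.card (Nat.Partition n.toNat) else 0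

namespace Nat.Partition

/-- Partitions of `n + 1` having their number of parts as a part correspond to partitions of `n`
without part `1`: remove that part and increase each of the others by one. -/
def cardMemPartsEquiv (n : ℕ) :
    {l : (n + 1).Partition // l.parts.card ∈ l.parts} ≃ {q : n.Partition // 1 ∉ q.parts} where
  toFun l := by
    refine ⟨⟨(l.1.parts.erase l.1.parts.card).map (· + 1), ?_, ?_⟩, ?_⟩
    · intro i hi
      obtain ⟨j, -, rfl⟩ := Multiset.mem_map.1 hi
      exact j.succ_pos
    · have hs := congrArg Multiset.sum (Multiset.cons_erase l.2)
      have hc := congrArg Multiset.card (Multiset.cons_erase l.2)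
      rw [Multiset.sum_cons, l.1.parts_sum] at hs
      rw [Multiset.card_cons] at hc
      simp only [Multiset.sum_map_add, Multiset.map_id', Multiset.map_const', Multiset.sum_replicate,
        smul_eq_mul, mul_one]
      lia
    · intro h
      obtain ⟨j, hj, hj1⟩ := Multiset.mem_map.1 h
      have := l.1.parts_pos (Multiset.mem_of_mem_erase hj)
      lia
  invFun q := by
    have hmap : (q.1.parts.map (· - 1)).map (· + 1) = q.1.parts := by
      rw [Multiset.map_map]
      refine (Multiset.map_congr rfl fun i hi ↦ ?_).trans (Multiset.map_id _)
      have := q.1.parts_pos hi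
      simp only [Function.comp_apply, id_eq]
      lia
    refine ⟨⟨(q.1.parts.card + 1) ::ₘ q.1.parts.map (· - 1), ?_, ?_⟩, ?_⟩
    · intro i hi
      rcases Multiset.mem_cons.1 hi with rfl | hi
      · exact Nat.succ_pos _
      · obtain ⟨j, hj, rfl⟩ := Multiset.mem_map.1 hi
        have := q.1.parts_pos hj
        have : j ≠ 1 := fun h ↦ q.2 (h ▸ hj)
        lia
    · have hs := congrArg Multiset.sum hmap
      rw [q.1.parts_sum] at hs
      simp only [Multiset.sum_map_add, Multiset.map_id', Multiset.map_const', Multiset.sum_replicate,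
        smul_eq_mul, mul_one, Multiset.card_map] at hs
      rw [Multiset.sum_cons]
      lia
    · simp
  left_inv l := by
    refine Subtype.ext <| Partition.ext ?_
    have hc := congrArg Multiset.card (Multiset.cons_erase l.2)
    rw [Multiset.card_cons] at hc
    simp only [Multiset.card_map, Multiset.map_map, Function.comp_def, Nat.add_sub_cancel,
      Multiset.map_id']
    rw [hc, Multiset.cons_erase l.2]
  right_inv q := by
    refine Subtype.ext <| Partition.ext ?_
    simp only [Multiset.card_cons, Multiset.card_map, Multiset.erase_cons_head, Multiset.map_map]
    refine (Multiset.map_congr rfl fun i hi ↦ ?_).trans (Multiset.map_id _)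
    have := q.1.parts_pos hi
    simp only [Function.comp_apply, id_eq]
    lia

theorem card_eq_card_one_mem_add_card_one_notMem (n : ℕ) :
    Nat.card n.Partition =
      Nat.card {q : n.Partition // 1 ∈ q.parts} + Nat.card {q : n.Partition // 1 ∉ q.parts} := by
  rw [← Nat.card_sum, Nat.card_congr (Equiv.sumCompl fun q : n.Partition ↦ 1 ∈ q.parts)]

end Nat.Partition

theorem partitionFn_natCast (n : ℕ) : partitionFn n = Nat.card n.Partition := by
  simp [partitionFn]

theorem card_one_mem_parts (n : ℕ) :
    Nat.card {q : n.Partition // 1 ∈ q.parts} = partitionFn ((n : ℤ) - 1) := by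
  cases n with
  | zero => simp [partitionFn]
  | succ n =>
    rw [Nat.card_congr (Nat.Partition.partitionWithPartEquiv le_rfl n.succ_pos),
      Nat.cast_succ, add_sub_cancel_right, partitionFn_natCast, Nat.succ_sub_one]

theorem g_natCast_succ (n : ℕ) :
    g ((n : ℤ) + 1) = Nat.card {q : n.Partition // 1 ∉ q.parts} := by
  rw [g, if_pos (by positivity), ← Nat.card_congr (Nat.Partition.cardMemPartsEquiv n)]
  rfl

theorem g_eq_partitionFn_sub (k : ℤ) (hk : 1 ≤ k) :
    (g k : ℤ) = (partitionFn (k - 1) : ℤ) - (partitionFn (k - 2) : ℤ) := by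
  obtain ⟨n, rfl⟩ : ∃ n : ℕ, k = n + 1 := ⟨(k - 1).toNat, by lia⟩
  have h := Nat.Partition.card_eq_card_one_mem_add_card_one_notMem n
  rw [card_one_mem_parts, ← g_natCast_succ, ← partitionFn_natCast] at h
  rw [add_sub_cancel_right, show (n : ℤ) + 1 - 2 = n - 1 by ring, h]
  push_cast
  ring
end

section
/- Let $n \geq 1$ be an integer and let $a, b$ be real numbers with $b \geq a \geq n/2 - 2$. Then the number of partitions $\lambda$ of $n$ with $a \leq \operatorname{rank}(\lambda) \leq b$ equals $p(n - \lceil a \rceil - 1) - p(n - \lfloor b \rfloor - 2)$, where $p$ is the partition function with $p(0) = 1$ and $p(x) = 0$ for $x$ not a non-negative integer. -/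
theorem Multiset.sup_mem_of_ne_zero_s7 {A : Multiset ℕ} (hA : A ≠ 0) : A.sup ∈ A := by
  induction A using Multiset.induction_on with
  | empty => exact absurd rfl hA
  | cons x B ih =>
    rw [Multiset.sup_cons]
    by_cases hB : B = 0
    · simp [hB]
    · rcases max_choice x B.sup with h | h
      · simp [h]
      · exact Multiset.mem_cons_of_mem (by simpa [h] using ih hB)

theorem Multiset.add_card_le_sum_add_one {A : Multiset ℕ} (hA : ∀ x ∈ A, 0 < x) {x : ℕ}
    (hx : x ∈ A) : x + A.card ≤ A.sum + 1 := by
  obtain ⟨B, rfl⟩ := Multiset.exists_cons_of_mem hx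
  have h := Multiset.card_nsmul_le_sum (s := B) (a := 1)
    fun y hy => hA y (Multiset.mem_cons_of_mem hy)
  simp only [smul_eq_mul, mul_one] at h
  simp only [Multiset.card_cons, Multiset.sum_cons]
  omega

/-- Deletes the first column of the Young diagram whose row lengths are `A`. -/
def Multiset.removeColumn (A : Multiset ℕ) : Multiset ℕ :=
  (A.map Nat.pred).filter (0 < ·)

/-- Adds a first column of height `r` (if `r` is at least the number of rows) to the Young diagram
whose row lengths are `A`. -/
def Multiset.addColumn (A : Multiset ℕ) (r : ℕ) : Multiset ℕ :=
  A.map Nat.succ + Multiset.replicate (r - A.card) 1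

theorem Multiset.card_removeColumn_le (A : Multiset ℕ) : A.removeColumn.card ≤ A.card := by
  simpa [Multiset.removeColumn] using
    Multiset.card_le_card (Multiset.filter_le (0 < ·) (A.map Nat.pred))

theorem Multiset.card_addColumn {A : Multiset ℕ} {r : ℕ} (h : A.card ≤ r) :
    (A.addColumn r).card = r := by
  simp [Multiset.addColumn, h]

theorem Multiset.sum_addColumn {A : Multiset ℕ} {r : ℕ} (h : A.card ≤ r) :
    (A.addColumn r).sum = A.sum + r := by
  simp only [Multiset.addColumn, Multiset.sum_add, Nat.succ_eq_add_one, Multiset.sum_map_add,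
    Multiset.map_id', Multiset.map_const', Multiset.sum_replicate, smul_eq_mul, mul_one]
  omega

theorem Multiset.pos_of_mem_addColumn {A : Multiset ℕ} {r x : ℕ} (hx : x ∈ A.addColumn r) :
    0 < x := by
  rw [Multiset.addColumn, Multiset.mem_add, Multiset.mem_map] at hx
  rcases hx with ⟨y, -, rfl⟩ | hx
  · exact y.succ_pos
  · simp [Multiset.eq_of_mem_replicate hx]

theorem Multiset.removeColumn_addColumn {A : Multiset ℕ} (hA : ∀ x ∈ A, 0 < x) (r : ℕ) :
    (A.addColumn r).removeColumn = A := by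
  have h : (Multiset.replicate (r - A.card) 0).filter (0 < ·) = 0 :=
    Multiset.filter_eq_nil.2 fun x hx => by simp [Multiset.eq_of_mem_replicate hx]
  simp [Multiset.addColumn, Multiset.removeColumn, Multiset.filter_eq_self.2 hA, h]

theorem Multiset.addColumn_removeColumn {A : Multiset ℕ} (hA : ∀ x ∈ A, 0 < x) :
    A.removeColumn.addColumn A.card = A := by
  induction A using Multiset.induction_on with
  | empty => simp [Multiset.addColumn, Multiset.removeColumn]
  | cons x B ih =>
    have ihB := ih fun y hy => hA y (Multiset.mem_cons_of_mem hy)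
    have hx := hA x (Multiset.mem_cons_self x B)
    have hc := B.card_removeColumn_le
    unfold Multiset.addColumn Multiset.removeColumn at *
    by_cases h : 0 < x.pred
    · rw [Multiset.map_cons, Multiset.filter_cons_of_pos _ h, Multiset.map_cons,
        Multiset.card_cons, Multiset.card_cons, Nat.add_sub_add_right, Multiset.cons_add, ihB,
        Nat.succ_pred_eq_of_pos hx]
    · have hx1 : x = 1 := by
        rw [Nat.pred_eq_sub_one] at h
        omega
      rw [Multiset.map_cons, Multiset.filter_cons_of_neg _ h, Multiset.card_cons,
        Nat.sub_add_comm hc, Multiset.replicate_succ, Multiset.add_cons, ihB, hx1]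

theorem Multiset.sum_removeColumn_add_card {A : Multiset ℕ} (hA : ∀ x ∈ A, 0 < x) :
    A.removeColumn.sum + A.card = A.sum := by
  rw [← Multiset.sum_addColumn A.card_removeColumn_le, Multiset.addColumn_removeColumn hA]

theorem Multiset.pos_of_mem_removeColumn {A : Multiset ℕ} {x : ℕ} (hx : x ∈ A.removeColumn) :
    0 < x :=
  (Multiset.mem_filter.1 hx).2

theorem Multiset.add_card_le_of_mem_removeColumn {A : Multiset ℕ} (hA : ∀ x ∈ A, 0 < x) {x : ℕ}
    (hx : x ∈ A.removeColumn) : x + A.card ≤ A.sum := by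
  obtain ⟨y, hy, rfl⟩ := Multiset.mem_map.1 (Multiset.mem_filter.1 hx).1
  have h := Multiset.add_card_le_sum_add_one hA hy
  have := hA y hy
  rw [Nat.pred_eq_sub_one]
  omega

theorem Multiset.sup_cons_eq_of_forall_le {A : Multiset ℕ} {s : ℕ} (h : ∀ x ∈ A, x ≤ s) :
    (s ::ₘ A).sup = s := by
  rw [Multiset.sup_cons]
  exact sup_eq_left.2 (Multiset.sup_le.2 h)

theorem Nat.Partition.sup_mem_parts_s7 {n : ℕ} (hn : 1 ≤ n) (l : n.Partition) :
    l.parts.sup ∈ l.parts := by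
  refine Multiset.sup_mem_of_ne_zero_s7 fun h => ?_
  have := l.parts_sum
  simp [h] at this
  omega

theorem Nat.Partition.sup_add_sum_erase {n : ℕ} (hn : 1 ≤ n) (l : n.Partition) :
    l.parts.sup + (l.parts.erase l.parts.sup).sum = n := by
  rw [Multiset.sum_erase (l.sup_mem_parts_s7 hn), l.parts_sum]

theorem Nat.Partition.card_erase_le_of_le_rank {n : ℕ} (hn : 1 ≤ n) {m : ℤ} {l : n.Partition}
    (h : m ≤ l.rank) :
    ((l.parts.erase l.parts.sup).card : ℤ) ≤ l.parts.sup - m - 1 := by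
  have := Multiset.card_erase_add_one (l.sup_mem_parts_s7 hn)
  unfold Nat.Partition.rank at h
  omega

/-- Dyson's map: delete the largest part and adjoin a column, turning the partitions of `n` of
rank at least `m` into the partitions of `n - m - 1`, provided `m ≥ n / 2 - 2`. -/
def Nat.Partition.dysonEquiv {n N : ℕ} {m : ℤ} (hn : 1 ≤ n) (hm : (n : ℤ) ≤ 2 * m + 4)
    (hN : (N : ℤ) = n - m - 1) : {l : n.Partition // m ≤ l.rank} ≃ N.Partition where
  toFun l :=
    { parts := (l.1.parts.erase l.1.parts.sup).addColumn (l.1.parts.sup - m - 1).toNat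
      parts_pos := Multiset.pos_of_mem_addColumn
      parts_sum := by
        have h := Nat.Partition.card_erase_le_of_le_rank hn l.2
        have h2 := l.1.sup_add_sum_erase hn
        rw [Multiset.sum_addColumn (by omega)]
        omega }
  invFun v :=
    ⟨{  parts := (v.parts.card + m + 1).toNat ::ₘ v.parts.removeColumn
        parts_pos := by
          intro i hi
          rcases Multiset.mem_cons.1 hi with rfl | hi
          · have h := v.parts_sum
            rcases Nat.eq_zero_or_pos v.parts.card with h0 | h0
            · rw [Multiset.card_eq_zero.1 h0, Multiset.sum_zero] at h
              omega
            · omega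
          · exact Multiset.pos_of_mem_removeColumn hi
        parts_sum := by
          have h := Multiset.sum_removeColumn_add_card fun x hx => v.parts_pos hx
          rw [v.parts_sum] at h
          rw [Multiset.sum_cons]
          have h0 : 0 ≤ (v.parts.card : ℤ) + m + 1 := by omega
          omega }, by
      have h := v.parts.card_removeColumn_le
      have h1 : (v.parts.card + m + 1).toNat ≤
          ((v.parts.card + m + 1).toNat ::ₘ v.parts.removeColumn).sup := by
        rw [Multiset.sup_cons]
        exact le_sup_left
      dsimp only [Nat.Partition.rank]
      rw [Multiset.card_cons]
      omega⟩
  left_inv l := by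
    have h := Nat.Partition.card_erase_le_of_le_rank hn l.2
    apply Subtype.ext
    apply Nat.Partition.ext
    dsimp only
    rw [Multiset.card_addColumn (by omega), Multiset.removeColumn_addColumn
      fun x hx => l.1.parts_pos (Multiset.mem_of_mem_erase hx)]
    rw [show (((l.1.parts.sup - m - 1).toNat : ℤ) + m + 1).toNat = l.1.parts.sup by omega,
      Multiset.cons_erase (l.1.sup_mem_parts_s7 hn)]
  right_inv v := by
    have h : ∀ x ∈ v.parts.removeColumn, x ≤ (v.parts.card + m + 1).toNat := by
      intro x hx
      have h1 := Multiset.add_card_le_of_mem_removeColumn (fun x hx => v.parts_pos hx) hx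
      have h2 : v.parts.removeColumn.card ≠ 0 := (Multiset.card_pos_iff_exists_mem.2 ⟨x, hx⟩).ne'
      have h3 := v.parts.card_removeColumn_le
      rw [v.parts_sum] at h1
      omega
    apply Nat.Partition.ext
    dsimp only
    rw [Multiset.sup_cons_eq_of_forall_le h, Multiset.erase_cons_head]
    have h0 : ((((v.parts.card + m + 1).toNat : ℤ)) - m - 1).toNat = v.parts.card := by omega
    rw [h0, Multiset.addColumn_removeColumn fun x hx => v.parts_pos hx]

theorem Nat.Partition.card_le_rank {n : ℕ} (hn : 1 ≤ n) {m : ℤ} (hm : (n : ℤ) ≤ 2 * m + 4) :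
    Nat.card {l : n.Partition // m ≤ l.rank} = partitionFn (n - m - 1) := by
  rw [partitionFn]
  split_ifs with h
  · exact Nat.card_congr (Nat.Partition.dysonEquiv hn hm (Int.toNat_of_nonneg h))
  · have : IsEmpty {l : n.Partition // m ≤ l.rank} := by
      refine ⟨fun l => ?_⟩
      have h1 := Nat.Partition.card_erase_le_of_le_rank hn l.2
      have h2 := l.1.sup_add_sum_erase hn
      omega
    exact Nat.card_of_isEmpty

theorem card_rank_mem_Icc (n : ℤ) (hn : 1 ≤ n) (a b : ℝ)
    (hab : a ≤ b) (ha : (n : ℝ) / 2 - 2 ≤ a) :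
    (Nat.card {l : Nat.Partition n.toNat // a ≤ (l.rank : ℝ) ∧ (l.rank : ℝ) ≤ b} : ℤ)
      = (partitionFn (n - ⌈a⌉ - 1) : ℤ) - (partitionFn (n - ⌊b⌋ - 2) : ℤ) := by
  obtain ⟨k, rfl⟩ := Int.eq_ofNat_of_zero_le (by omega : 0 ≤ n)
  change (Nat.card {l : k.Partition // a ≤ (l.rank : ℝ) ∧ (l.rank : ℝ) ≤ b} : ℤ) = _
  have hk : 1 ≤ k := by omega
  have hm : (k : ℤ) ≤ 2 * ⌈a⌉ + 4 := by
    have h := Int.le_ceil a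
    push_cast at ha
    have : (k : ℝ) ≤ 2 * ⌈a⌉ + 4 := by linarith
    exact_mod_cast this
  have hfc : ⌈a⌉ ≤ ⌊b⌋ + 1 := (Int.ceil_le_floor_add_one a).trans (by gcongr)
  have h1 := Nat.Partition.card_le_rank hk hm
  have h2 := Nat.Partition.card_le_rank hk (m := ⌊b⌋ + 1) (by omega)
  rw [show (k : ℤ) - (⌊b⌋ + 1) - 1 = k - ⌊b⌋ - 2 by ring] at h2
  rw [← h1, ← h2]
  simp only [Nat.card_eq_fintype_card, Fintype.card_subtype, ← Int.ceil_le, ← Int.le_floor]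
  rw [eq_sub_iff_add_eq, ← Nat.cast_add, ← Finset.card_union_of_disjoint]
  · congr 2
    ext l
    simp only [Finset.mem_union, Finset.mem_filter, Finset.mem_univ, true_and]
    omega
  · rw [Finset.disjoint_filter]
    intro l _ h
    omega
end

section
/- As $n \to \infty$, the proportion of partitions of $n$ whose rank is at least $n/2$ satisfies the asymptotic $\#\{\lambda \in P(n) : \operatorname{rank}(\lambda) \geq n/2\} / p(n) = p(\lfloor n/2 \rfloor - 1)/p(n) \sim 2 e^{\pi (1 - \sqrt{2}) \sqrt{n/3}}$, i.e., the ratio of the left-hand side to the right-hand side tends to $1$. -/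
namespace PartitionAsymptotics

open Filter Topology PowerSeries Finset

/-- Euler's product `∏ (1 - q ^ n)` over `n ≥ 1`. -/
noncomputable def eulerProd (q : ℂ) : ℂ := ∏' n : ℕ, (1 - q ^ (n + 1))

section Coefficients

/-- `φ` converges absolutely at `q` with sum `c`. -/
def AbsHasSumAt (φ : ℂ⟦X⟧) (q c : ℂ) : Prop :=
  Summable (fun n ↦ ‖coeff n φ * q ^ n‖) ∧ ∑' n, coeff n φ * q ^ n = c

lemma AbsHasSumAt.one (q : ℂ) : AbsHasSumAt 1 q 1 := by
  have h : ∀ n, n ≠ 0 → coeff n (1 : ℂ⟦X⟧) * q ^ n = 0 := fun n hn ↦ by simp [coeff_one, hn]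
  refine ⟨(hasSum_single 0 fun n hn ↦ by rw [h n hn, norm_zero]).summable, ?_⟩
  rw [tsum_eq_single 0 h]
  simp

lemma AbsHasSumAt.mul {φ ψ : ℂ⟦X⟧} {q a b : ℂ} (hφ : AbsHasSumAt φ q a)
    (hψ : AbsHasSumAt ψ q b) : AbsHasSumAt (φ * ψ) q (a * b) := by
  have key : ∀ n, coeff n (φ * ψ) * q ^ n =
      ∑ kl ∈ antidiagonal n, coeff kl.1 φ * q ^ kl.1 * (coeff kl.2 ψ * q ^ kl.2) := by
    intro n
    rw [coeff_mul, Finset.sum_mul]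
    refine Finset.sum_congr rfl fun kl hkl ↦ ?_
    rw [← mem_antidiagonal.mp hkl, pow_add]
    ring
  have hfun : (fun n ↦ coeff n (φ * ψ) * q ^ n) = fun n ↦
      ∑ kl ∈ antidiagonal n, coeff kl.1 φ * q ^ kl.1 * (coeff kl.2 ψ * q ^ kl.2) := funext key
  have hsum := summable_norm_sum_mul_antidiagonal_of_summable_norm hφ.1 hψ.1
  have htsum := tsum_mul_tsum_eq_tsum_sum_antidiagonal_of_summable_norm hφ.1 hψ.1
  refine ⟨hsum.congr fun n ↦ by rw [key], ?_⟩
  rw [hfun, ← htsum, hφ.2, hψ.2]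

open scoped PowerSeries.WithPiTopology in
lemma coeff_tsum_X_pow {k : ℕ} (hk : 0 < k) (n : ℕ) :
    coeff n (∑' j : ℕ, (X : ℂ⟦X⟧) ^ (k * j)) = if k ∣ n then 1 else 0 := by
  have hs : Summable fun j : ℕ ↦ (X : ℂ⟦X⟧) ^ (k * j) := by
    simp_rw [pow_mul]
    exact PowerSeries.WithPiTopology.summable_pow_of_constantCoeff_eq_zero (by simp [hk.ne'])
  rw [hs.map_tsum _ (WithPiTopology.continuous_coeff _ _)]
  simp_rw [coeff_X_pow]
  split_ifs with h
  · obtain ⟨m, rfl⟩ := h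
    rw [tsum_eq_single m]
    · simp
    · intro j hj
      rw [if_neg]
      intro h
      exact hj (Nat.eq_of_mul_eq_mul_left hk h).symm
  · convert tsum_zero with j
    exact if_neg fun hn ↦ h ⟨j, hn⟩

open scoped PowerSeries.WithPiTopology in
lemma absHasSumAt_tsum_X_pow {k : ℕ} (hk : 0 < k) {q : ℂ} (hq : ‖q‖ < 1) :
    AbsHasSumAt (∑' j : ℕ, (X : ℂ⟦X⟧) ^ (k * j)) q (1 - q ^ k)⁻¹ := by
  have hinj : Function.Injective (fun j : ℕ ↦ k * j) := fun a b h ↦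
    Nat.eq_of_mul_eq_mul_left hk h
  have hqk : ‖q ^ k‖ < 1 := by
    rw [norm_pow]
    exact pow_lt_one₀ (norm_nonneg _) hq hk.ne'
  have hsupp : ∀ n ∉ Set.range (fun j : ℕ ↦ k * j),
      coeff n (∑' j : ℕ, (X : ℂ⟦X⟧) ^ (k * j)) * q ^ n = 0 := by
    intro n hn
    rw [coeff_tsum_X_pow hk, if_neg, zero_mul]
    rintro ⟨j, rfl⟩
    exact hn ⟨j, rfl⟩
  have hcomp : ∀ j : ℕ, coeff (k * j) (∑' j : ℕ, (X : ℂ⟦X⟧) ^ (k * j)) * q ^ (k * j) =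
      (q ^ k) ^ j := fun j ↦ by rw [coeff_tsum_X_pow hk]; simp [pow_mul]
  refine ⟨?_, ?_⟩
  · rw [← hinj.summable_iff (fun n hn ↦ by rw [hsupp n hn, norm_zero])]
    simp only [Function.comp_def, hcomp, norm_pow]
    rw [norm_pow] at hqk
    exact summable_geometric_of_lt_one (by positivity) hqk
  · refine HasSum.tsum_eq ?_
    rw [← hinj.hasSum_iff hsupp]
    simp only [Function.comp_def, hcomp]
    exact hasSum_geometric_of_norm_lt_one hqk

open scoped PowerSeries.WithPiTopology in
lemma absHasSumAt_prod (N : ℕ) {q : ℂ} (hq : ‖q‖ < 1) :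
    AbsHasSumAt (∏ i ∈ range N, ∑' j : ℕ, (X : ℂ⟦X⟧) ^ ((i + 1) * j)) q
      (∏ i ∈ range N, (1 - q ^ (i + 1)))⁻¹ := by
  induction N with
  | zero => simpa using AbsHasSumAt.one q
  | succ N ih =>
    rw [prod_range_succ, prod_range_succ, mul_inv]
    exact ih.mul (absHasSumAt_tsum_X_pow N.succ_pos hq)

open scoped PowerSeries.WithPiTopology in
lemma tendsto_coeff_prod (n : ℕ) :
    Tendsto (fun N ↦ coeff n (∏ i ∈ range N, ∑' j : ℕ, (X : ℂ⟦X⟧) ^ ((i + 1) * j))) atTop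
      (𝓝 (Nat.card n.Partition : ℂ)) := by
  have h := (Nat.Partition.hasProd_powerSeriesMk_card_restricted ℂ
    (fun _ ↦ True)).tendsto_prod_nat
  have := (WithPiTopology.tendsto_iff_coeff_tendsto _ _ _ _).mp h n
  simpa [Nat.Partition.restricted, Nat.card_eq_fintype_card] using this

lemma integral_exp_int_mul_I (k : ℤ) :
    ∫ θ in (-Real.pi)..Real.pi, Complex.exp (k * θ * Complex.I) =
      if k = 0 then 2 * (Real.pi : ℂ) else 0 := by
  split_ifs with h
  · subst h
    simp
    ring
  · have hc : (k : ℂ) * Complex.I ≠ 0 := by simp [h]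
    have : ∀ θ : ℝ, (k : ℂ) * θ * Complex.I = k * Complex.I * θ := fun θ ↦ by ring
    simp_rw [this]
    rw [integral_exp_mul_complex hc, div_eq_zero_iff]
    left
    rw [sub_eq_zero, Complex.exp_eq_exp_iff_exists_int]
    exact ⟨k, by push_cast; ring⟩

lemma AbsHasSumAt.integral_eq {φ : ℂ⟦X⟧} {r : ℝ} (hr : 0 ≤ r) {f : ℂ → ℂ}
    (h : ∀ q : ℂ, ‖q‖ = r → AbsHasSumAt φ q (f q)) (n : ℕ) :
    ∫ θ in (-Real.pi)..Real.pi,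
        f (r * Complex.exp (θ * Complex.I)) * Complex.exp (-(n * θ * Complex.I)) =
      2 * Real.pi * (coeff n φ * r ^ n) := by
  have hnorm : ∀ θ : ℝ, ‖(r : ℂ) * Complex.exp (θ * Complex.I)‖ = r := fun θ ↦ by
    rw [norm_mul, Complex.norm_exp_ofReal_mul_I, Complex.norm_real, Real.norm_of_nonneg hr,
      mul_one]
  have hterm : ∀ (k : ℕ) (θ : ℝ), coeff k φ * (r * Complex.exp (θ * Complex.I)) ^ k *
      Complex.exp (-(n * θ * Complex.I)) =
      coeff k φ * r ^ k * Complex.exp (((k : ℤ) - (n : ℤ) : ℤ) * θ * Complex.I) := by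
    intro k θ
    rw [mul_pow, ← Complex.exp_nat_mul, mul_assoc, mul_assoc, ← Complex.exp_add, ← mul_assoc]
    congr 2
    push_cast
    ring
  have hsum : HasSum (fun k : ℕ ↦ ∫ θ in (-Real.pi)..Real.pi,
      coeff k φ * (r * Complex.exp (θ * Complex.I)) ^ k * Complex.exp (-(n * θ * Complex.I)))
      (∫ θ in (-Real.pi)..Real.pi,
        f (r * Complex.exp (θ * Complex.I)) * Complex.exp (-(n * θ * Complex.I))) := by
    refine intervalIntegral.hasSum_integral_of_dominated_convergence
      (fun k _ ↦ ‖coeff k φ * (r : ℂ) ^ k‖) ?_ ?_ ?_ ?_ ?_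
    · intro k
      exact Continuous.aestronglyMeasurable (by fun_prop)
    · refine fun k ↦ .of_forall fun θ _ ↦ ?_
      rw [hterm, norm_mul, ← Complex.ofReal_intCast, ← Complex.ofReal_mul,
        Complex.norm_exp_ofReal_mul_I, mul_one]
    · exact .of_forall fun θ _ ↦
        (h r (by rw [Complex.norm_real, Real.norm_of_nonneg hr])).1
    · exact intervalIntegrable_const
    · refine .of_forall fun θ _ ↦ ?_
      have := h _ (hnorm θ)
      rw [← this.2]
      exact (this.1.of_norm.hasSum).mul_right _
  rw [← hsum.tsum_eq, tsum_eq_single n]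
  · simp_rw [hterm]
    rw [intervalIntegral.integral_const_mul, integral_exp_int_mul_I]
    simp
    ring
  · intro k hk
    simp_rw [hterm]
    rw [intervalIntegral.integral_const_mul, integral_exp_int_mul_I, if_neg, mul_zero]
    omega

lemma one_sub_norm_pow_le (q : ℂ) (n : ℕ) :
    1 - ‖q‖ ^ (n + 1) ≤ ‖1 - q ^ (n + 1)‖ := by
  have := norm_sub_norm_le (1 : ℂ) (q ^ (n + 1))
  simpa using this

lemma one_sub_pow_pos {r : ℝ} (hr : 0 ≤ r) (hr1 : r < 1) (n : ℕ) : 0 < 1 - r ^ (n + 1) :=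
  sub_pos.mpr (pow_lt_one₀ hr hr1 n.succ_ne_zero)

lemma tendsto_prod_eulerProd {q : ℂ} (hq : ‖q‖ < 1) :
    Tendsto (fun N ↦ ∏ i ∈ range N, (1 - q ^ (i + 1))) atTop (𝓝 (eulerProd q)) :=
  (ModularForm.multipliable_one_sub_pow hq).hasProd.tendsto_prod_nat

lemma eulerProd_ne_zero {q : ℂ} (hq : ‖q‖ < 1) : eulerProd q ≠ 0 := by
  have : eulerProd q = ∏' n : ℕ, (1 + -q ^ (n + 1)) := by simp [eulerProd, sub_eq_add_neg]
  rw [this]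
  refine tprod_one_add_ne_zero_of_summable (f := fun n ↦ -q ^ (n + 1)) (fun n h ↦ ?_) ?_
  · have h1 := one_sub_norm_pow_le q n
    have h2 := one_sub_pow_pos (norm_nonneg q) hq n
    rw [sub_eq_add_neg (1 : ℂ), h, norm_zero] at h1
    linarith
  · simpa using (summable_nat_add_iff 1).mpr (summable_geometric_of_lt_one (norm_nonneg _) hq)

lemma tendsto_prod_inv_eulerProd {q : ℂ} (hq : ‖q‖ < 1) :
    Tendsto (fun N ↦ (∏ i ∈ range N, (1 - q ^ (i + 1)))⁻¹) atTop (𝓝 (eulerProd q)⁻¹) :=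
  (tendsto_prod_eulerProd hq).inv₀ (eulerProd_ne_zero hq)

/-- Cauchy's formula for the number of partitions. -/
lemma integral_inv_eulerProd {r : ℝ} (hr : 0 ≤ r) (hr1 : r < 1) (n : ℕ) :
    ∫ θ in (-Real.pi)..Real.pi, (eulerProd (r * Complex.exp (θ * Complex.I)))⁻¹ *
        Complex.exp (-(n * θ * Complex.I)) =
      2 * Real.pi * (Nat.card n.Partition * r ^ n) := by
  have hnorm : ∀ θ : ℝ, ‖(r : ℂ) * Complex.exp (θ * Complex.I)‖ = r := fun θ ↦ by
    rw [norm_mul, Complex.norm_exp_ofReal_mul_I, Complex.norm_real, Real.norm_of_nonneg hr,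
      mul_one]
  have hR : Tendsto (fun N ↦ ‖(∏ i ∈ range N, (1 - (r : ℂ) ^ (i + 1)))⁻¹‖) atTop
      (𝓝 ‖(eulerProd r)⁻¹‖) :=
    (tendsto_prod_inv_eulerProd (by rwa [Complex.norm_real, Real.norm_of_nonneg hr])).norm
  obtain ⟨B, hB⟩ := hR.bddAbove_range
  have hlim : Tendsto (fun N : ℕ ↦ ∫ θ in (-Real.pi)..Real.pi,
      (∏ i ∈ range N, (1 - (r * Complex.exp (θ * Complex.I)) ^ (i + 1)))⁻¹ *
        Complex.exp (-(n * θ * Complex.I))) atTop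
      (𝓝 (∫ θ in (-Real.pi)..Real.pi, (eulerProd (r * Complex.exp (θ * Complex.I)))⁻¹ *
        Complex.exp (-(n * θ * Complex.I)))) := by
    refine intervalIntegral.tendsto_integral_filter_of_dominated_convergence (fun _ ↦ B) ?_ ?_ ?_ ?_
    · refine .of_forall fun N ↦ Measurable.aestronglyMeasurable ?_
      fun_prop
    · refine .of_forall fun N ↦ .of_forall fun θ _ ↦ ?_
      have hexp : ‖Complex.exp (-(n * θ * Complex.I))‖ = 1 := by
        rw [← neg_mul, ← Complex.ofReal_natCast, ← Complex.ofReal_mul, ← Complex.ofReal_neg,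
          Complex.norm_exp_ofReal_mul_I]
      rw [norm_mul, hexp, mul_one]
      refine le_trans ?_ (hB ⟨N, rfl⟩)
      dsimp only
      rw [norm_inv, norm_inv, norm_prod, norm_prod]
      have hpos : ∀ i : ℕ, ‖1 - (r : ℂ) ^ (i + 1)‖ = 1 - r ^ (i + 1) := fun i ↦ by
        rw [← Complex.ofReal_pow, ← Complex.ofReal_one, ← Complex.ofReal_sub, Complex.norm_real,
          Real.norm_of_nonneg (one_sub_pow_pos hr hr1 i).le]
      simp_rw [hpos]
      refine inv_anti₀ (prod_pos fun i _ ↦ one_sub_pow_pos hr hr1 i)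
        (prod_le_prod (fun i _ ↦ (one_sub_pow_pos hr hr1 i).le) fun i _ ↦ ?_)
      have := one_sub_norm_pow_le (r * Complex.exp (θ * Complex.I)) i
      rwa [hnorm] at this
    · exact intervalIntegrable_const
    · refine .of_forall fun θ _ ↦ ?_
      exact (tendsto_prod_inv_eulerProd (by rwa [hnorm])).mul_const _
  refine tendsto_nhds_unique hlim ?_
  have : ∀ N : ℕ, ∫ θ in (-Real.pi)..Real.pi,
      (∏ i ∈ range N, (1 - (r * Complex.exp (θ * Complex.I)) ^ (i + 1)))⁻¹ *
        Complex.exp (-(n * θ * Complex.I)) = _ :=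
    fun N ↦ AbsHasSumAt.integral_eq (f := fun q ↦ (∏ i ∈ range N, (1 - q ^ (i + 1)))⁻¹) hr
      (fun q hq ↦ absHasSumAt_prod N (by rwa [hq])) n
  simp_rw [this]
  exact ((tendsto_coeff_prod n).mul_const _).const_mul _

end Coefficients

section ModularTransformation

open Complex in
lemma eta_mul_I_div_two_pi (s : ℂ) :
    ModularForm.eta (I * s / (2 * Real.pi)) = exp (-s / 24) * eulerProd (exp (-s)) := by
  have hpi : (Real.pi : ℂ) ≠ 0 := by exact_mod_cast Real.pi_ne_zero
  have h1 : 2 * Real.pi * I * (I * s / (2 * Real.pi)) = -s := by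
    field_simp
    simp
  unfold ModularForm.eta eulerProd
  simp_rw [ModularForm.eta_q_eq_pow, Function.Periodic.qParam, h1]
  simp

open Complex in
/-- The modular transformation of Euler's product. -/
lemma inv_eulerProd_exp_neg {s : ℂ} (hs : 0 < s.re) :
    (eulerProd (exp (-s)))⁻¹ = exp (-s / 24) * ((sqrt I)⁻¹ * sqrt (I * s / (2 * Real.pi))) *
      exp (Real.pi ^ 2 / (6 * s)) * (eulerProd (exp (-(4 * Real.pi ^ 2 / s))))⁻¹ := by
  have hpi : (Real.pi : ℂ) ≠ 0 := by exact_mod_cast Real.pi_ne_zero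
  have hs0 : s ≠ 0 := by rintro rfl; simp at hs
  have hmem : I * s / (2 * Real.pi) ∈ UpperHalfPlane.upperHalfPlaneSet := by
    have : I * s / (2 * Real.pi) = I * s / ((2 * Real.pi : ℝ) : ℂ) := by push_cast; ring
    rw [this]
    simp only [UpperHalfPlane.upperHalfPlaneSet, Set.mem_ofPred_eq, div_ofReal_im]
    have : (I * s).im = s.re := by simp
    rw [this]
    positivity
  have h := ModularForm.eta_comp_eq_csqrt_I_inv hmem
  have harg : -1 / (I * s / (2 * Real.pi)) = I * (4 * Real.pi ^ 2 / s) / (2 * Real.pi) := by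
    field_simp
    simp
    ring
  simp only [Function.comp_apply, Pi.smul_apply, Pi.mul_apply, smul_eq_mul] at h
  rw [harg, eta_mul_I_div_two_pi, eta_mul_I_div_two_pi] at h
  have hn : ∀ w : ℂ, 0 < w.re → eulerProd (exp (-w)) ≠ 0 := fun w hw ↦
    eulerProd_ne_zero (by rw [norm_exp]; simpa using hw)
  have hre : 0 < (4 * (Real.pi : ℂ) ^ 2 / s).re := by
    have : (4 * (Real.pi : ℂ) ^ 2 / s) = ((4 * Real.pi ^ 2 : ℝ) : ℂ) * s⁻¹ := by
      push_cast; ring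
    rw [this, re_ofReal_mul, inv_re]
    have := normSq_pos.mpr hs0
    positivity
  have h1 := hn s hs
  have h2 := hn _ hre
  have he : exp (-(4 * (Real.pi : ℂ) ^ 2 / s) / 24) * exp (Real.pi ^ 2 / (6 * s)) = 1 := by
    rw [← exp_add, ← exp_zero]
    congr 1
    field_simp
    ring
  rw [eq_mul_inv_iff_mul_eq₀ h2, inv_mul_eq_iff_eq_mul₀ h1]
  calc _ = exp (-(4 * (Real.pi : ℂ) ^ 2 / s) / 24) *
        eulerProd (exp (-(4 * Real.pi ^ 2 / s))) * exp (Real.pi ^ 2 / (6 * s)) := by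
        rw [mul_right_comm, he, one_mul]
    _ = _ := by rw [h]; ring

open Complex in
lemma sqrt_ofReal_sq_mul {τ : ℝ} (hτ : 0 < τ) {w : ℂ} (hw : w ≠ 0) :
    sqrt ((τ : ℂ) ^ 2 * w) = τ * sqrt w := by
  have h0 : (τ : ℂ) ≠ 0 := by exact_mod_cast hτ.ne'
  have hpos : 0 < τ ^ 2 := by positivity
  rw [sqrt_eq_exp (mul_ne_zero (pow_ne_zero 2 h0) hw), sqrt_eq_exp hw, ← ofReal_pow,
    log_ofReal_mul hpos hw, Real.log_pow]
  rw [show (((2 : ℕ) : ℝ) * Real.log τ : ℝ) = 2 * Real.log τ by norm_num]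
  rw [add_div, exp_add]
  congr 1
  push_cast
  rw [mul_div_cancel_left₀ _ (two_ne_zero), ← ofReal_exp, Real.exp_log hτ]

/-- The saddle point path: `s = τ² (1 - i u τ)`. -/
noncomputable def path (τ u : ℝ) : ℂ := τ ^ 2 * (1 - u * τ * Complex.I)

/-- The integrand along the saddle point path, after removing its main growth. -/
noncomputable def saddleIntegrand (τ u : ℝ) : ℂ :=
  Complex.exp (-path τ u / 24) *
    ((Complex.sqrt Complex.I)⁻¹ *
      Complex.sqrt (Complex.I * (1 - u * τ * Complex.I) / (2 * Real.pi))) *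
    Complex.exp (-(Real.pi ^ 2 / 6 * u ^ 2 / (1 - u * τ * Complex.I))) *
    (eulerProd (Complex.exp (-(4 * Real.pi ^ 2 / path τ u))))⁻¹

lemma one_sub_mul_I_ne_zero (x y : ℝ) : 1 - (x : ℂ) * y * Complex.I ≠ 0 := by
  intro h
  simpa using congrArg Complex.re h

lemma path_re (τ u : ℝ) : (path τ u).re = τ ^ 2 := by
  have : path τ u = ((τ ^ 2 : ℝ) : ℂ) * (1 - u * τ * Complex.I) := by simp [path]
  rw [this, Complex.re_ofReal_mul]
  simp

open Complex in
lemma inv_eulerProd_path {τ : ℝ} (hτ : 0 < τ) (u : ℝ) :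
    (eulerProd (exp (-path τ u)))⁻¹ * exp (Real.pi ^ 2 / (6 * τ ^ 4) * path τ u) =
      τ * exp (Real.pi ^ 2 / (3 * τ ^ 2)) * saddleIntegrand τ u := by
  have hpi : (Real.pi : ℂ) ≠ 0 := by exact_mod_cast Real.pi_ne_zero
  have h0 : (τ : ℂ) ≠ 0 := by exact_mod_cast hτ.ne'
  have hw := one_sub_mul_I_ne_zero u τ
  have hre : 0 < (path τ u).re := by rw [path_re]; positivity
  have hsqrt : sqrt (I * path τ u / (2 * Real.pi)) =
      τ * sqrt (I * (1 - u * τ * I) / (2 * Real.pi)) := by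
    rw [← sqrt_ofReal_sq_mul hτ (by simp [hpi, hw])]
    congr 1
    rw [path]
    ring
  have hexp : exp (Real.pi ^ 2 / (6 * path τ u)) * exp (Real.pi ^ 2 / (6 * τ ^ 4) * path τ u) =
      exp (Real.pi ^ 2 / (3 * τ ^ 2)) * exp (-(Real.pi ^ 2 / 6 * u ^ 2 / (1 - u * τ * I))) := by
    rw [← exp_add, ← exp_add]
    congr 1
    rw [path]
    generalize hwd : 1 - (u : ℂ) * τ * I = w at *
    have hu : (u : ℂ) ^ 2 * τ ^ 2 = -(1 - w) ^ 2 := by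
      rw [← hwd]
      ring_nf
      simp
    field_simp
    linear_combination 3 * hu
  rw [inv_eulerProd_exp_neg hre, hsqrt, saddleIntegrand]
  linear_combination (exp (-path τ u / 24) * ((sqrt I)⁻¹ *
    (τ * sqrt (I * (1 - u * τ * I) / (2 * Real.pi)))) *
    (eulerProd (exp (-(4 * Real.pi ^ 2 / path τ u))))⁻¹) * hexp

lemma continuousAt_eulerProd_zero : ContinuousAt eulerProd 0 :=
  (ModularForm.differentiableOn_tprod_one_sub_pow.differentiableAt
    (Metric.ball_mem_nhds 0 one_pos)).continuousAt

lemma eulerProd_zero : eulerProd 0 = 1 := by simp [eulerProd]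

open Complex in
lemma tendsto_exp_neg_inv_path (u : ℝ) :
    Tendsto (fun τ : ℝ ↦ exp (-(4 * Real.pi ^ 2 / path τ u))) (𝓝[>] 0) (𝓝 0) := by
  rw [tendsto_zero_iff_norm_tendsto_zero]
  have hre : ∀ τ : ℝ, (-(4 * (Real.pi : ℂ) ^ 2 / path τ u)).re =
      -(4 * Real.pi ^ 2 * ((1 + (u * τ) ^ 2)⁻¹ * (τ ^ 2)⁻¹)) := by
    intro τ
    have h1 : -(4 * (Real.pi : ℂ) ^ 2 / path τ u) =
        ((-(4 * Real.pi ^ 2 * (τ ^ 2)⁻¹) : ℝ) : ℂ) * (1 - u * τ * I)⁻¹ := by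
      rw [path]
      push_cast
      rw [div_eq_mul_inv, mul_inv]
      ring
    have h2 : normSq (1 - u * τ * I) = 1 + (u * τ) ^ 2 := by
      rw [normSq_apply]
      simp
      ring
    rw [h1, re_ofReal_mul, inv_re, h2]
    simp
    ring
  simp_rw [norm_exp, hre]
  refine Real.tendsto_exp_neg_atTop_nhds_zero.comp ?_
  refine Tendsto.const_mul_atTop (by positivity) ?_
  have h1 : Tendsto (fun τ : ℝ ↦ (1 + (u * τ) ^ 2)⁻¹) (𝓝[>] 0) (𝓝 1) := by
    have : ContinuousAt (fun τ : ℝ ↦ (1 + (u * τ) ^ 2)⁻¹) 0 :=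
      ContinuousAt.inv₀ (by fun_prop) (by simp)
    have := this.tendsto
    simp only [mul_zero, ne_eq, OfNat.ofNat_ne_zero, not_false_eq_true, zero_pow, add_zero,
      inv_one] at this
    exact this.mono_left nhdsWithin_le_nhds
  refine h1.pos_mul_atTop one_pos ?_
  refine tendsto_inv_nhdsGT_zero.comp ?_
  refine tendsto_nhdsWithin_iff.mpr ⟨?_, ?_⟩
  · have : ContinuousAt (fun τ : ℝ ↦ τ ^ 2) 0 := by fun_prop
    simpa using this.tendsto.mono_left nhdsWithin_le_nhds
  · filter_upwards [self_mem_nhdsWithin] with τ hτ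
    exact pow_pos (Set.mem_Ioi.mp hτ) 2

/-- The constant in front of the limiting Gaussian. -/
noncomputable def saddleConst : ℂ :=
  (Complex.sqrt Complex.I)⁻¹ * Complex.sqrt (Complex.I / (2 * Real.pi))

lemma saddleConst_ne_zero : saddleConst ≠ 0 := by
  simp [saddleConst, Complex.sqrt, Real.pi_ne_zero]

open Complex in
lemma tendsto_saddleIntegrand (u : ℝ) :
    Tendsto (fun τ ↦ saddleIntegrand τ u) (𝓝[>] 0)
      (𝓝 (saddleConst * (Real.exp (-(Real.pi ^ 2 / 6) * u ^ 2) : ℝ))) := by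
  have h1 : Tendsto (fun τ : ℝ ↦ exp (-path τ u / 24)) (𝓝[>] 0) (𝓝 1) := by
    have : Continuous (fun τ : ℝ ↦ exp (-path τ u / 24)) := by unfold path; fun_prop
    have := this.tendsto 0
    simp only [path, ofReal_zero, ne_eq, OfNat.ofNat_ne_zero, not_false_eq_true, zero_pow,
      zero_mul, neg_zero, zero_div, exp_zero] at this
    exact this.mono_left nhdsWithin_le_nhds
  have h2 : Tendsto (fun τ : ℝ ↦ sqrt (I * (1 - u * τ * I) / (2 * Real.pi))) (𝓝[>] 0)
      (𝓝 (sqrt (I / (2 * Real.pi)))) := by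
    have hc : ContinuousAt (fun τ : ℝ ↦ I * (1 - u * τ * I) / (2 * Real.pi)) 0 := by
      fun_prop
    have hslit : I * (1 - u * ((0 : ℝ) : ℂ) * I) / (2 * Real.pi) ∈ slitPlane := by
      have : I * (1 - u * ((0 : ℝ) : ℂ) * I) / (2 * Real.pi) =
        ((2 * Real.pi)⁻¹ : ℝ) * I := by
        push_cast; simp; ring
      rw [this, mem_slitPlane_iff]
      right
      rw [im_ofReal_mul]
      simp [Real.pi_ne_zero]
    have := (hc.cpow (continuousAt_const (y := (2⁻¹ : ℂ))) hslit).tendsto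
    simp only [ofReal_zero, mul_zero, zero_mul, sub_zero, mul_one] at this
    exact this.mono_left nhdsWithin_le_nhds
  have h3 : Tendsto (fun τ : ℝ ↦ exp (-(Real.pi ^ 2 / 6 * u ^ 2 / (1 - u * τ * I)))) (𝓝[>] 0)
      (𝓝 (Real.exp (-(Real.pi ^ 2 / 6) * u ^ 2) : ℝ)) := by
    have hc : Continuous (fun τ : ℝ ↦ exp (-(Real.pi ^ 2 / 6 * u ^ 2 / (1 - u * τ * I)))) :=
      continuous_exp.comp (Continuous.div (by fun_prop) (by fun_prop)
        fun τ ↦ one_sub_mul_I_ne_zero u τ).neg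
    have := hc.tendsto 0
    simp only [ofReal_zero, mul_zero, zero_mul, sub_zero, div_one] at this
    push_cast
    rw [neg_mul]
    exact this.mono_left nhdsWithin_le_nhds
  have h4 := (continuousAt_eulerProd_zero.tendsto.comp (tendsto_exp_neg_inv_path u)).inv₀
    (by rw [eulerProd_zero]; exact one_ne_zero)
  rw [eulerProd_zero, inv_one] at h4
  simpa [saddleConst, saddleIntegrand] using
    ((h1.mul (h2.const_mul (sqrt I)⁻¹)).mul h3).mul h4

end ModularTransformation

section MinorArcs

open Complex in
lemma one_sub_norm_le_norm_one_sub_mul_exp {z : ℂ} (hz : ‖z‖ < 1) :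
    1 - ‖z‖ ≤ ‖1 - z‖ * Real.exp (z.re - ‖z‖) := by
  have h1 : 0 < 1 - ‖z‖ := by linarith
  have hz1 : 0 < ‖1 - z‖ := by
    have := norm_sub_norm_le (1 : ℂ) z
    rw [norm_one] at this
    linarith
  have hs1 := hasSum_re (hasSum_taylorSeries_neg_log hz)
  have hs2 := hasSum_re (hasSum_taylorSeries_neg_log (z := (‖z‖ : ℂ)) (by simpa using hz))
  have hlog1 : (-log (1 - z)).re = -Real.log ‖1 - z‖ := by rw [neg_re, log_re]
  have hlog2 : (-log (1 - (‖z‖ : ℂ))).re = -Real.log (1 - ‖z‖) := by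
    rw [neg_re, log_re, ← ofReal_one, ← ofReal_sub, norm_real, Real.norm_of_nonneg h1.le]
  rw [hlog1] at hs1
  rw [hlog2] at hs2
  have hterm : ∀ n : ℕ, 0 ≤ (((‖z‖ : ℂ) ^ n / n).re - (z ^ n / n).re) := by
    intro n
    have e1 : ((‖z‖ : ℂ) ^ n / n).re = ‖z‖ ^ n / n := by
      rw [← ofReal_pow, ← ofReal_natCast, ← ofReal_div, ofReal_re]
    have e2 : (z ^ n / n).re ≤ ‖z‖ ^ n / n := by
      refine (re_le_norm _).trans ?_
      simp
    rw [e1]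
    linarith
  have hle := le_hasSum (hs2.sub hs1) 1 fun j _ ↦ hterm j
  simp only [pow_one, Nat.cast_one, div_one, ofReal_re] at hle
  have hlogle : Real.log (1 - ‖z‖) ≤ Real.log ‖1 - z‖ + (z.re - ‖z‖) := by linarith
  calc 1 - ‖z‖ = Real.exp (Real.log (1 - ‖z‖)) := (Real.exp_log h1).symm
    _ ≤ Real.exp (Real.log ‖1 - z‖ + (z.re - ‖z‖)) := Real.exp_le_exp.mpr hlogle
    _ = _ := by rw [Real.exp_add, Real.exp_log hz1]

open Complex in
lemma norm_eulerProd_norm_le {z : ℂ} (hz : ‖z‖ < 1) :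
    ‖eulerProd ‖z‖‖ ≤ ‖eulerProd z‖ * Real.exp ((z / (1 - z)).re - ‖z‖ / (1 - ‖z‖)) := by
  have hgeo : ∀ w : ℂ, ‖w‖ < 1 → HasSum (fun n : ℕ ↦ w ^ (n + 1)) (w / (1 - w)) := by
    intro w hw
    simpa [pow_succ', div_eq_mul_inv] using (hasSum_geometric_of_norm_lt_one hw).mul_left w
  have hr : HasSum (fun n : ℕ ↦ ‖z‖ ^ (n + 1)) (‖z‖ / (1 - ‖z‖)) := by
    simpa [pow_succ', div_eq_mul_inv] using
      (hasSum_geometric_of_lt_one (norm_nonneg z) hz).mul_left ‖z‖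
  have hexp := ((hasSum_re (hgeo z hz)).sub hr).tendsto_sum_nat.rexp
  have hL := (tendsto_prod_eulerProd (q := (‖z‖ : ℂ)) (by simpa using hz)).norm
  have hR := (tendsto_prod_eulerProd hz).norm.mul hexp
  refine le_of_tendsto_of_tendsto' hL hR fun N ↦ ?_
  rw [norm_prod, norm_prod, Real.exp_sum, ← prod_mul_distrib]
  refine prod_le_prod (fun _ _ ↦ norm_nonneg _) fun i _ ↦ ?_
  have hzi : ‖z ^ (i + 1)‖ < 1 := by
    rw [norm_pow]
    exact pow_lt_one₀ (norm_nonneg _) hz i.succ_ne_zero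
  have h := one_sub_norm_le_norm_one_sub_mul_exp hzi
  rw [norm_pow] at h
  rwa [← ofReal_pow, ← ofReal_one, ← ofReal_sub, norm_real,
    Real.norm_of_nonneg (one_sub_pow_pos (norm_nonneg z) hz i).le]

open Complex in
lemma re_div_one_sub_sub {r θ : ℝ} (hr : 0 ≤ r) (hr1 : r < 1) :
    ((r * exp (θ * I)) / (1 - r * exp (θ * I))).re - r / (1 - r) =
      -(r * (1 + r) * (1 - Real.cos θ) /
        ((1 - r) * ((1 - r) ^ 2 + 2 * r * (1 - Real.cos θ)))) := by
  have h1 : 0 < 1 - r := by linarith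
  have hc : 0 ≤ 1 - Real.cos θ := by linarith [Real.cos_le_one θ]
  have hD : 0 < (1 - r) ^ 2 + 2 * r * (1 - Real.cos θ) := by positivity
  have hre : (r * exp (θ * I)).re = r * Real.cos θ := by
    rw [re_ofReal_mul, exp_ofReal_mul_I_re]
  have him : (r * exp (θ * I)).im = r * Real.sin θ := by
    rw [im_ofReal_mul, exp_ofReal_mul_I_im]
  have hn : normSq (1 - r * exp (θ * I)) = (1 - r) ^ 2 + 2 * r * (1 - Real.cos θ) := by
    rw [normSq_apply, sub_re, sub_im, hre, him, one_re, one_im]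
    linear_combination r ^ 2 * Real.sin_sq_add_cos_sq θ
  rw [div_re, hn, sub_re, sub_im, hre, him, one_re, one_im]
  field_simp
  linear_combination (-r ^ 2 * (1 - r)) * Real.sin_sq_add_cos_sq θ

lemma minor_arc_exponent_le {r t θ : ℝ} (hr : 1 / 2 ≤ r) (hr1 : r < 1) (hrt : 1 - r ≤ t)
    (hθ : |θ| ≤ Real.pi) :
    θ ^ 2 / (10 * t * (t ^ 2 + θ ^ 2)) ≤ r * (1 + r) * (1 - Real.cos θ) /
        ((1 - r) * ((1 - r) ^ 2 + 2 * r * (1 - Real.cos θ))) := by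
  have h1 : 0 < 1 - r := by linarith
  have ht : 0 < t := by linarith
  have hc : θ ^ 2 / 5 ≤ 1 - Real.cos θ := by
    have h2 := Real.cos_le_one_sub_mul_cos_sq hθ
    have h3 : 1 / 5 ≤ 2 / Real.pi ^ 2 := by
      rw [div_le_div_iff₀ (by norm_num) (by positivity)]
      nlinarith [Real.pi_lt_d2, Real.pi_pos]
    nlinarith [sq_nonneg θ]
  generalize 1 - Real.cos θ = c at hc
  rcases eq_or_ne θ 0 with rfl | hθ0
  · simp only [ne_eq, OfNat.ofNat_ne_zero, not_false_eq_true, zero_pow, zero_div] at hc ⊢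
    positivity
  have hθ2 : 0 < θ ^ 2 := by positivity
  have hc0 : 0 < c := by linarith
  have hstep : (1 / 2) * c / (t * (t ^ 2 + 2 * c)) ≤
      r * (1 + r) * c / ((1 - r) * ((1 - r) ^ 2 + 2 * r * c)) := by
    have hn : (1 / 2) * c ≤ r * (1 + r) * c := by
      refine mul_le_mul_of_nonneg_right ?_ hc0.le
      nlinarith
    have hd : (1 - r) * ((1 - r) ^ 2 + 2 * r * c) ≤ t * (t ^ 2 + 2 * c) := by
      refine mul_le_mul hrt ?_ (by positivity) ht.le
      nlinarith
    exact div_le_div₀ (by positivity) hn (by positivity) hd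
  refine le_trans ?_ hstep
  rw [div_le_div_iff₀ (by positivity) (by positivity)]
  have : 0 ≤ t * (t ^ 2 * (5 * c - θ ^ 2) + 3 * θ ^ 2 * c) := by
    have : 0 ≤ 5 * c - θ ^ 2 := by linarith
    positivity
  nlinarith

open Complex in
lemma norm_inv_eulerProd_le {t θ : ℝ} (ht : 0 < t) (ht2 : t ≤ 1 / 2) (hθ : |θ| ≤ Real.pi) :
    ‖(eulerProd (exp (-t + θ * I)))⁻¹‖ ≤ ‖(eulerProd (exp (-t)))⁻¹‖ *
      Real.exp (-(θ ^ 2 / (10 * t * (t ^ 2 + θ ^ 2)))) := by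
  set r := Real.exp (-t) with hrdef
  have hr1 : r < 1 := Real.exp_lt_one_iff.mpr (by linarith)
  have hr0 : 0 < r := Real.exp_pos _
  have hrt : 1 - r ≤ t := by linarith [Real.add_one_le_exp (-t)]
  have hr : (exp (-t) : ℂ) = r := by rw [hrdef]; push_cast; rfl
  rw [exp_add, hr]
  have hnorm : ‖(r : ℂ) * exp (θ * I)‖ = r := by
    rw [norm_mul, norm_exp_ofReal_mul_I, norm_real, Real.norm_of_nonneg hr0.le, mul_one]
  have hz : ‖(r : ℂ) * exp (θ * I)‖ < 1 := by rwa [hnorm]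
  have h := norm_eulerProd_norm_le hz
  rw [hnorm, re_div_one_sub_sub hr0.le hr1] at h
  have h1 : 0 < ‖eulerProd (r * exp (θ * I))‖ := norm_pos_iff.mpr (eulerProd_ne_zero hz)
  have h2 : 0 < ‖eulerProd r‖ := norm_pos_iff.mpr
    (eulerProd_ne_zero (by rwa [norm_real, Real.norm_of_nonneg hr0.le]))
  have h3 := h.trans (mul_le_mul_of_nonneg_left (Real.exp_le_exp.mpr (neg_le_neg
    (minor_arc_exponent_le (r := r) (by linarith) hr1 hrt hθ))) h1.le)
  rw [norm_inv, norm_inv, inv_le_iff_one_le_mul₀ h1, inv_mul_eq_div, div_mul_eq_mul_div,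
    le_div_iff₀ h2, one_mul]
  linarith

lemma exp_neg_minor_arc_le {u t : ℝ} (ht : 0 < t) (hut : u ^ 2 * t ^ 3 ≤ 10) :
    Real.exp (-(u ^ 2 / (10 * (1 + u ^ 2 * t)))) ≤ 10 ^ 6 * (1 + u ^ 2)⁻¹ := by
  set w := u ^ 2 with hw
  have hw0 : 0 ≤ w := sq_nonneg u
  have hy0 : 0 ≤ w / (10 * (1 + w * t)) := by positivity
  set y := w / (10 * (1 + w * t)) with hy
  have h1 : 1 ≤ Real.exp y := Real.one_le_exp hy0
  have key : 1 + w ≤ 10 ^ 6 * Real.exp y := by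
    rcases le_total (w * t) 1 with h | h
    · have : w / 20 ≤ y := by
        rw [hy]
        refine div_le_div_of_nonneg_left hw0 (by positivity) (by linarith)
      linarith [Real.add_one_le_exp y]
    · have h2 : 1 / (20 * t) ≤ y := by
        rw [hy, div_le_div_iff₀ (by positivity) (by positivity)]
        linarith
      have h3 := Real.pow_div_factorial_le_exp y hy0 3
      have h4 : (1 / (20 * t)) ^ 3 ≤ y ^ 3 := pow_le_pow_left₀ (by positivity) h2 3
      have h5 : w ≤ 10 * (1 / t ^ 3) := by
        rw [mul_one_div, le_div_iff₀ (by positivity)]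
        exact hut
      have h6 : (1 / (20 * t)) ^ 3 = 1 / 8000 * (1 / t ^ 3) := by
        field_simp
        norm_num
      rw [h6] at h4
      have h7 : ((Nat.factorial 3 : ℕ) : ℝ) = 6 := by norm_num [Nat.factorial]
      rw [h7] at h3
      linarith
  rw [Real.exp_neg, ← div_eq_mul_inv, le_div_iff₀ (by positivity), inv_mul_le_iff₀ (by positivity)]
  linarith

end MinorArcs

section Asymptotics

open Complex in
lemma card_partition_eq_integral {τ : ℝ} (hτ : 0 < τ) {n : ℕ}
    (hn : (n : ℝ) = Real.pi ^ 2 / (6 * τ ^ 4)) :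
    (2 * Real.pi * Nat.card n.Partition : ℂ) = τ ^ 4 * exp (Real.pi ^ 2 / (3 * τ ^ 2)) *
      ∫ u in (-(Real.pi / τ ^ 3))..(Real.pi / τ ^ 3), saddleIntegrand τ u := by
  have h0 : (τ : ℂ) ≠ 0 := by exact_mod_cast hτ.ne'
  have hn' : (n : ℂ) = Real.pi ^ 2 / (6 * τ ^ 4) := by
    rw [← ofReal_natCast, hn]
    push_cast
    rfl
  have hr1 : Real.exp (-τ ^ 2) < 1 := Real.exp_lt_one_iff.mpr (by nlinarith)
  have hcauchy := integral_inv_eulerProd (Real.exp_pos (-τ ^ 2)).le hr1 n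
  have hsub := intervalIntegral.integral_comp_mul_left (a := -(Real.pi / τ ^ 3))
    (b := Real.pi / τ ^ 3) (c := τ ^ 3)
    (fun θ : ℝ ↦ (eulerProd (Real.exp (-τ ^ 2) * exp (θ * I)))⁻¹ * exp (-(n * θ * I)))
    (pow_ne_zero 3 hτ.ne')
  rw [mul_neg, mul_div_cancel₀ _ (pow_ne_zero 3 hτ.ne'), hcauchy] at hsub
  have hg : ∀ u : ℝ, exp (n * τ ^ 2) * ((eulerProd (Real.exp (-τ ^ 2) *
      exp ((τ ^ 3 * u : ℝ) * I)))⁻¹ * exp (-(n * (τ ^ 3 * u : ℝ) * I))) =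
      τ * exp (Real.pi ^ 2 / (3 * τ ^ 2)) * saddleIntegrand τ u := by
    intro u
    rw [← inv_eulerProd_path hτ, mul_left_comm, ← exp_add, ofReal_exp, ← exp_add, ← hn']
    congr 3
    · congr 1
      rw [path]
      push_cast
      ring
    · rw [path]
      push_cast
      ring
  have hr : exp (n * τ ^ 2) * (Real.exp (-τ ^ 2) : ℂ) ^ n = 1 := by
    rw [ofReal_exp, ← exp_nat_mul, ← exp_add, ← exp_zero]
    congr 1
    push_cast
    ring
  have hmul := congrArg (exp (n * τ ^ 2) * ·) hsub
  simp only [← intervalIntegral.integral_const_mul, hg] at hmul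
  rw [intervalIntegral.integral_const_mul, real_smul] at hmul
  push_cast at hmul hr
  have h3 : (τ : ℂ) ^ 3 * ((τ : ℂ) ^ 3)⁻¹ = 1 := mul_inv_cancel₀ (pow_ne_zero 3 h0)
  calc (2 * Real.pi * Nat.card n.Partition : ℂ) =
      τ ^ 3 * (exp (n * τ ^ 2) * (((τ : ℂ) ^ 3)⁻¹ *
        (2 * Real.pi * (Nat.card n.Partition * exp (-τ ^ 2) ^ n)))) := by
        linear_combination (-(2 * Real.pi * Nat.card n.Partition : ℂ)) * hr
          - (2 * Real.pi * Nat.card n.Partition * (exp (n * τ ^ 2) * exp (-τ ^ 2) ^ n) : ℂ) * h3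
    _ = _ := by rw [← hmul]; ring

open Complex in
lemma continuous_saddleIntegrand {τ : ℝ} (hτ : 0 < τ) : Continuous (saddleIntegrand τ) := by
  have h0 : (τ : ℂ) ≠ 0 := by exact_mod_cast hτ.ne'
  have hmem : ∀ u, exp (-path τ u) ∈ Metric.ball (0 : ℂ) 1 := by
    intro u
    rw [mem_ball_zero_iff, norm_exp, neg_re, path_re]
    exact Real.exp_lt_one_iff.mpr (by nlinarith)
  have hpath : Continuous (path τ) := by unfold path; fun_prop
  have hc : Continuous fun u ↦ (eulerProd (exp (-path τ u)))⁻¹ :=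
    (ModularForm.differentiableOn_tprod_one_sub_pow.continuousOn.comp_continuous
      (by fun_prop) hmem).inv₀ fun u ↦ eulerProd_ne_zero (by simpa using hmem u)
  have heq : saddleIntegrand τ = fun u ↦ (τ * exp (Real.pi ^ 2 / (3 * τ ^ 2)))⁻¹ *
      ((eulerProd (exp (-path τ u)))⁻¹ * exp (Real.pi ^ 2 / (6 * τ ^ 4) * path τ u)) := by
    funext u
    rw [inv_eulerProd_path hτ, inv_mul_cancel_left₀ (mul_ne_zero h0 (exp_ne_zero _))]
  rw [heq]
  fun_prop

open Complex in
lemma norm_saddleIntegrand_le {τ u : ℝ} (hτ : 0 < τ) (hτ2 : τ ^ 2 ≤ 1 / 2)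
    (hu : |u| ≤ Real.pi / τ ^ 3) :
    ‖saddleIntegrand τ u‖ ≤ ‖saddleIntegrand τ 0‖ * (10 ^ 6 * (1 + u ^ 2)⁻¹) := by
  have hθ : |u * τ ^ 3| ≤ Real.pi := by
    rw [abs_mul, abs_of_pos (pow_pos hτ 3)]
    exact (le_div_iff₀ (pow_pos hτ 3)).mp hu
  have hn : ∀ v : ℝ, ‖(eulerProd (exp (-path τ v)))⁻¹‖ * Real.exp (Real.pi ^ 2 / (6 * τ ^ 2)) =
      τ * Real.exp (Real.pi ^ 2 / (3 * τ ^ 2)) * ‖saddleIntegrand τ v‖ := by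
    intro v
    have h := congrArg norm (inv_eulerProd_path hτ v)
    have e1 : (Real.pi ^ 2 / (6 * τ ^ 4) * path τ v : ℂ) =
        ((Real.pi ^ 2 / (6 * τ ^ 4) : ℝ) : ℂ) * path τ v := by push_cast; rfl
    have e2 : (Real.pi ^ 2 / (3 * τ ^ 2) : ℂ) = ((Real.pi ^ 2 / (3 * τ ^ 2) : ℝ) : ℂ) := by
      push_cast; rfl
    rw [norm_mul, norm_mul, norm_mul, norm_exp, norm_exp, e1, e2, re_ofReal_mul, path_re,
      ofReal_re, norm_real, Real.norm_of_nonneg hτ.le] at h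
    rw [← h]
    congr 2
    field_simp
  have hle := norm_inv_eulerProd_le (pow_pos hτ 2) hτ2 hθ
  have e3 : -((τ ^ 2 : ℝ) : ℂ) + (u * τ ^ 3 : ℝ) * I = -path τ u := by
    rw [path]; push_cast; ring
  have e4 : -((τ ^ 2 : ℝ) : ℂ) = -path τ 0 := by
    rw [path]; push_cast; ring
  rw [e3, e4] at hle
  have e5 : (u * τ ^ 3) ^ 2 / (10 * τ ^ 2 * ((τ ^ 2) ^ 2 + (u * τ ^ 3) ^ 2)) =
      u ^ 2 / (10 * (1 + u ^ 2 * τ ^ 2)) := by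
    field_simp
  have hmin : Real.exp (-(u ^ 2 / (10 * (1 + u ^ 2 * τ ^ 2)))) ≤ 10 ^ 6 * (1 + u ^ 2)⁻¹ := by
    refine exp_neg_minor_arc_le (pow_pos hτ 2) ?_
    have : u ^ 2 * (τ ^ 2) ^ 3 = |u * τ ^ 3| ^ 2 := by rw [sq_abs]; ring
    rw [this]
    nlinarith [abs_nonneg (u * τ ^ 3), Real.pi_lt_d2, Real.pi_pos]
  rw [e5] at hle
  have hle' := hle.trans (mul_le_mul_of_nonneg_left hmin (norm_nonneg _))
  have hpos : 0 < τ * Real.exp (Real.pi ^ 2 / (3 * τ ^ 2)) := by positivity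
  refine le_of_mul_le_mul_left ?_ hpos
  rw [← hn, ← mul_assoc, ← hn, mul_right_comm]
  exact mul_le_mul_of_nonneg_right hle' (Real.exp_pos _).le

lemma tendsto_integral_saddleIntegrand :
    Tendsto (fun τ ↦ ∫ u in (-(Real.pi / τ ^ 3))..(Real.pi / τ ^ 3), saddleIntegrand τ u)
      (𝓝[>] 0) (𝓝 (saddleConst * (√(Real.pi / (Real.pi ^ 2 / 6)) : ℝ))) := by
  rw [← integral_gaussian, ← integral_complex_ofReal, ← MeasureTheory.integral_const_mul]
  have hb : ∀ᶠ τ in 𝓝[>] (0 : ℝ), ‖saddleIntegrand τ 0‖ ≤ ‖saddleConst‖ + 1 := by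
    have h := (tendsto_saddleIntegrand 0).norm
    simp only [ne_eq, OfNat.ofNat_ne_zero, not_false_eq_true, zero_pow, mul_zero, Real.exp_zero,
      Complex.ofReal_one, mul_one] at h
    exact h.eventually_le_const (lt_add_one _)
  have hsmall : ∀ᶠ τ in 𝓝[>] (0 : ℝ), τ ^ 2 ≤ 1 / 2 := by
    have : Tendsto (fun τ : ℝ ↦ τ ^ 2) (𝓝[>] 0) (𝓝 0) := by
      have : Continuous (fun τ : ℝ ↦ τ ^ 2) := by fun_prop
      simpa using (this.tendsto 0).mono_left nhdsWithin_le_nhds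
    exact this.eventually_le_const (by norm_num)
  have hpos : ∀ᶠ τ in 𝓝[>] (0 : ℝ), 0 < τ := self_mem_nhdsWithin
  have hcube : Tendsto (fun τ : ℝ ↦ Real.pi / τ ^ 3) (𝓝[>] 0) atTop := by
    have h1 : Tendsto (fun τ : ℝ ↦ τ⁻¹ ^ 3) (𝓝[>] 0) atTop :=
      (tendsto_pow_atTop three_ne_zero).comp tendsto_inv_nhdsGT_zero
    simpa [div_eq_mul_inv] using h1.const_mul_atTop Real.pi_pos
  have hdom : Tendsto (fun τ : ℝ ↦ ∫ u, (Set.Ioc (-(Real.pi / τ ^ 3)) (Real.pi / τ ^ 3)).indicator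
      (saddleIntegrand τ) u) (𝓝[>] 0)
      (𝓝 (∫ u : ℝ, saddleConst * (Real.exp (-(Real.pi ^ 2 / 6) * u ^ 2) : ℝ))) := by
    refine MeasureTheory.tendsto_integral_filter_of_dominated_convergence
      (fun u : ℝ ↦ (‖saddleConst‖ + 1) * (10 ^ 6 * (1 + u ^ 2)⁻¹)) ?_ ?_ ?_ ?_
    · filter_upwards [hpos] with τ hτ
      exact (continuous_saddleIntegrand hτ).aestronglyMeasurable.indicator measurableSet_Ioc
    · filter_upwards [hpos, hb, hsmall] with τ hτ hbτ hsτ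
      refine Eventually.of_forall fun u ↦ ?_
      by_cases hu : u ∈ Set.Ioc (-(Real.pi / τ ^ 3)) (Real.pi / τ ^ 3)
      · rw [Set.indicator_of_mem hu]
        refine (norm_saddleIntegrand_le hτ hsτ (abs_le.mpr ⟨hu.1.le, hu.2⟩)).trans ?_
        exact mul_le_mul_of_nonneg_right hbτ (by positivity)
      · rw [Set.indicator_of_notMem hu, norm_zero]
        positivity
    · exact (integrable_inv_one_add_sq.const_mul _).const_mul _
    · refine Eventually.of_forall fun u ↦ ?_
      refine (tendsto_saddleIntegrand u).congr' ?_
      filter_upwards [hcube.eventually_gt_atTop |u|] with τ hτ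
      rw [Set.indicator_of_mem]
      exact ⟨(abs_lt.mp hτ).1, (abs_lt.mp hτ).2.le⟩
  refine hdom.congr' ?_
  filter_upwards [hpos] with τ hτ
  rw [MeasureTheory.integral_indicator measurableSet_Ioc, intervalIntegral.integral_of_le]
  have : 0 < Real.pi / τ ^ 3 := by positivity
  linarith

/-- The growth rate of the partition function, up to a constant factor. -/
noncomputable def partitionGrowth (n : ℕ) : ℝ :=
  (n : ℝ)⁻¹ * Real.exp (Real.pi * √2 * √(n / 3))

lemma exists_tendsto_card_partition_div :
    ∃ L : ℝ, L ≠ 0 ∧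
      Tendsto (fun n : ℕ ↦ (Nat.card n.Partition : ℝ) / partitionGrowth n) atTop (𝓝 L) := by
  set K : ℂ := saddleConst * (√(Real.pi / (Real.pi ^ 2 / 6)) : ℝ) with hK
  have hK0 : K ≠ 0 := by
    refine mul_ne_zero saddleConst_ne_zero ?_
    have : 0 < √(Real.pi / (Real.pi ^ 2 / 6)) := by positivity
    exact_mod_cast this.ne'
  let τ : ℕ → ℝ := fun n ↦ √(Real.pi * (√6)⁻¹ * (√n)⁻¹)
  have hτpos : ∀ n : ℕ, 0 < n → 0 < τ n := fun n hn ↦ by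
    have : (0 : ℝ) < n := by exact_mod_cast hn
    positivity
  have hτsq : ∀ n : ℕ, τ n ^ 2 = Real.pi * (√6)⁻¹ * (√n)⁻¹ := fun n ↦
    Real.sq_sqrt (by positivity)
  have hτ4 : ∀ n : ℕ, τ n ^ 4 = Real.pi ^ 2 / 6 * (n : ℝ)⁻¹ := fun n ↦ by
    have : τ n ^ 4 = (τ n ^ 2) ^ 2 := by ring
    rw [this, hτsq, mul_pow, mul_pow, inv_pow, inv_pow, Real.sq_sqrt (by norm_num),
      Real.sq_sqrt (Nat.cast_nonneg n)]
    ring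
  have hτlim : Tendsto τ atTop (𝓝[>] 0) := by
    refine tendsto_nhdsWithin_iff.mpr ⟨?_, ?_⟩
    · have h1 : Tendsto (fun n : ℕ ↦ (√(n : ℝ))⁻¹) atTop (𝓝 0) :=
        tendsto_inv_atTop_zero.comp (Real.tendsto_sqrt_atTop.comp tendsto_natCast_atTop_atTop)
      have h2 := (h1.const_mul (Real.pi * (√6)⁻¹)).sqrt
      rwa [mul_zero, Real.sqrt_zero] at h2
    · filter_upwards [eventually_gt_atTop 0] with n hn using hτpos n hn
  refine ⟨Real.pi ^ 2 / 6 * ‖K‖ / (2 * Real.pi), ?_, ?_⟩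
  · have := norm_pos_iff.mpr hK0
    positivity
  have hlim := (((tendsto_integral_saddleIntegrand.comp hτlim).norm).const_mul
    (Real.pi ^ 2 / 6)).div_const (2 * Real.pi)
  refine hlim.congr' ?_
  filter_upwards [eventually_gt_atTop 0] with n hn
  have hn0 : (0 : ℝ) < n := by exact_mod_cast hn
  have hτn := hτpos n hn
  have h := congrArg norm (card_partition_eq_integral (n := n) hτn (by rw [hτ4]; field_simp))
  have hexp : Real.pi ^ 2 / (3 * τ n ^ 2) = Real.pi * √2 * √(n / 3) := by
    rw [hτsq, Real.sqrt_div hn0.le]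
    have h6 : √6 = √2 * √3 := by rw [← Real.sqrt_mul (by norm_num)]; norm_num
    rw [h6]
    have h3 : √3 ^ 2 = (3 : ℝ) := Real.sq_sqrt (by norm_num)
    field_simp
    rw [h3]
  have e2 : (Real.pi ^ 2 / (3 * τ n ^ 2) : ℂ) = ((Real.pi ^ 2 / (3 * τ n ^ 2) : ℝ) : ℂ) := by
    push_cast; rfl
  rw [norm_mul, norm_mul, norm_mul, norm_mul, Complex.norm_natCast, norm_pow, e2, Complex.norm_exp,
    Complex.ofReal_re, Complex.norm_real, Complex.norm_real, Real.norm_of_nonneg hτn.le, hτ4,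
    hexp, Real.norm_of_nonneg Real.pi_pos.le, Complex.norm_ofNat] at h
  simp only [Function.comp_apply, partitionGrowth]
  rw [div_eq_div_iff (by positivity) (by positivity)]
  linarith

end Asymptotics

section LargeRank

lemma sum_map_add_one (μ : Multiset ℕ) : (μ.map (· + 1)).sum = μ.sum + μ.card := by
  simp [Multiset.sum_map_add]

lemma filter_ne_one_add_replicate (s : Multiset ℕ) :
    s.filter (· ≠ 1) + Multiset.replicate (s.count 1) 1 = s := by
  conv_rhs => rw [← Multiset.filter_add_not (· ≠ 1) s]
  simp [Multiset.filter_eq']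

lemma map_sub_one_map_add_one {M : ℕ} (ν : Nat.Partition M) :
    ((ν.parts.filter (· ≠ 1)).map (· - 1)).map (· + 1) = ν.parts.filter (· ≠ 1) := by
  rw [Multiset.map_map]
  refine (Multiset.map_congr rfl fun j hj ↦ ?_).trans (Multiset.map_id' _)
  exact Nat.sub_add_cancel (ν.parts_pos (Multiset.mem_filter.mp hj).1)

lemma cons_erase_sup {n : ℕ} (l : Nat.Partition n) (hn : n ≠ 0) :
    l.parts.sup ::ₘ l.parts.erase l.parts.sup = l.parts := by
  have hne : l.parts ≠ 0 := by
    intro h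
    have := l.parts_sum
    rw [h, Multiset.sum_zero] at this
    exact hn this.symm
  obtain ⟨y, hy, hmax⟩ := Multiset.exists_max_image id hne
  have : l.parts.sup = y := le_antisymm (Multiset.sup_le.mpr hmax) (Multiset.le_sup hy)
  rw [this, Multiset.cons_erase hy]

/-- Multisets of positive integers whose sum and cardinality add up to at most `M` correspond to
partitions of `M`: increase every part by one and fill up with ones. -/
def shiftEquiv (M : ℕ) :
    {μ : Multiset ℕ // (∀ i ∈ μ, 0 < i) ∧ μ.sum + μ.card ≤ M} ≃ Nat.Partition M where
  toFun μ :=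
    { parts := μ.1.map (· + 1) + Multiset.replicate (M - (μ.1.sum + μ.1.card)) 1
      parts_pos := by
        intro i hi
        rcases Multiset.mem_add.mp hi with h | h
        · obtain ⟨j, -, rfl⟩ := Multiset.mem_map.mp h
          exact j.succ_pos
        · rw [Multiset.eq_of_mem_replicate h]
          exact one_pos
      parts_sum := by
        have := μ.2.2
        rw [Multiset.sum_add, sum_map_add_one, Multiset.sum_replicate, smul_eq_mul]
        omega }
  invFun ν :=
    ⟨(ν.parts.filter (· ≠ 1)).map (· - 1), by
      refine ⟨fun i hi ↦ ?_, ?_⟩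
      · obtain ⟨j, hj, rfl⟩ := Multiset.mem_map.mp hi
        obtain ⟨hj, hj1⟩ := Multiset.mem_filter.mp hj
        have := ν.parts_pos hj
        omega
      · rw [← sum_map_add_one, map_sub_one_map_add_one ν]
        have := congrArg Multiset.sum (filter_ne_one_add_replicate ν.parts)
        rw [Multiset.sum_add, ν.parts_sum] at this
        omega⟩
  left_inv μ := by
    refine Subtype.ext ?_
    dsimp only
    rw [Multiset.filter_add, Multiset.filter_eq_self.mpr, Multiset.filter_eq_nil.mpr, add_zero,
      Multiset.map_map]
    · simp
    · intro i hi
      simp [Multiset.eq_of_mem_replicate hi]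
    · intro i hi
      obtain ⟨j, hj, rfl⟩ := Multiset.mem_map.mp hi
      have := μ.2.1 j hj
      omega
  right_inv ν := by
    refine Nat.Partition.ext ?_
    dsimp only
    have hsum := congrArg Multiset.sum (filter_ne_one_add_replicate ν.parts)
    rw [Multiset.sum_add, ν.parts_sum, Multiset.sum_replicate, smul_eq_mul, mul_one] at hsum
    rw [← sum_map_add_one, map_sub_one_map_add_one ν]
    conv_rhs => rw [← filter_ne_one_add_replicate ν.parts]
    congr 2
    omega

/-- Removing the largest part of a partition of large rank leaves a small multiset. -/
def eraseSupEquiv {n M : ℕ} (hM : M + 1 = n / 2) :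
    {l : Nat.Partition n // n + 2 * l.parts.card ≤ 2 * l.parts.sup} ≃
      {μ : Multiset ℕ // (∀ i ∈ μ, 0 < i) ∧ μ.sum + μ.card ≤ M} where
  toFun l :=
    ⟨l.1.parts.erase l.1.parts.sup, by
      have hcons := cons_erase_sup l.1 (by omega)
      refine ⟨fun i hi ↦ l.1.parts_pos (Multiset.mem_of_mem_erase hi), ?_⟩
      have h1 := congrArg Multiset.sum hcons
      have h2 := congrArg Multiset.card hcons
      have h3 := l.2
      rw [Multiset.sum_cons, l.1.parts_sum] at h1
      rw [Multiset.card_cons] at h2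
      omega⟩
  invFun μ :=
    ⟨{ parts := (n - μ.1.sum) ::ₘ μ.1
       parts_pos := by
        intro i hi
        have := μ.2.2
        rcases Multiset.mem_cons.mp hi with rfl | h
        · omega
        · exact μ.2.1 i h
       parts_sum := by
        have := μ.2.2
        rw [Multiset.sum_cons]
        omega }, by
      have := μ.2.2
      have h1 : n - μ.1.sum ≤ ((n - μ.1.sum) ::ₘ μ.1).sup :=
        Multiset.le_sup (Multiset.mem_cons_self _ _)
      dsimp only
      rw [Multiset.card_cons]
      omega⟩
  left_inv l := by
    have hcons := cons_erase_sup l.1 (by omega)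
    refine Subtype.ext (Nat.Partition.ext ?_)
    dsimp only
    have h1 := congrArg Multiset.sum hcons
    rw [Multiset.sum_cons, l.1.parts_sum] at h1
    conv_rhs => rw [← hcons]
    congr 1
    omega
  right_inv μ := by
    refine Subtype.ext ?_
    dsimp only
    have hsup : ((n - μ.1.sum) ::ₘ μ.1).sup = n - μ.1.sum := by
      rw [Multiset.sup_cons, sup_eq_left, Multiset.sup_le]
      intro b hb
      have := Multiset.le_sum_of_mem hb
      have := μ.2.2
      omega
    rw [hsup, Multiset.erase_cons_head]

lemma half_le_rank_iff {n : ℕ} (l : Nat.Partition n) :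
    (n : ℚ) / 2 ≤ (l.rank : ℚ) ↔ n + 2 * l.parts.card ≤ 2 * l.parts.sup := by
  rw [div_le_iff₀ two_pos]
  have h : (n : ℚ) ≤ (l.rank : ℚ) * 2 ↔ (n : ℤ) ≤ l.rank * 2 := by norm_cast
  rw [h, Nat.Partition.rank]
  omega

lemma floor_half_sub_one (n : ℕ) : ⌊(n : ℚ) / 2⌋ - 1 = ((n / 2 : ℕ) : ℤ) - 1 := by
  have h : ⌊(n : ℚ) / 2⌋ = ((n / 2 : ℕ) : ℤ) := by
    rw [← Nat.floor_div_eq_div (K := ℚ), ← Int.natCast_floor_eq_floor (by positivity)]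
    simp
  rw [h]

lemma card_large_rank_of_eq {n M : ℕ} (hM : M + 1 = n / 2) :
    Nat.card {l : Nat.Partition n // (n : ℚ) / 2 ≤ (l.rank : ℚ)} = Nat.card (Nat.Partition M) := by
  simp_rw [half_le_rank_iff]
  exact Nat.card_congr ((eraseSupEquiv hM).trans (shiftEquiv M))

lemma card_large_rank {n : ℕ} (hn : 1 ≤ n) :
    Nat.card {l : Nat.Partition n // (n : ℚ) / 2 ≤ (l.rank : ℚ)} =
      partitionFn (⌊(n : ℚ) / 2⌋ - 1) := by
  rw [floor_half_sub_one]
  rcases Nat.lt_or_ge 1 n with h | h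
  · obtain ⟨M, hM⟩ : ∃ M, M + 1 = n / 2 := ⟨n / 2 - 1, by omega⟩
    rw [card_large_rank_of_eq hM, ← hM, partitionFn]
    simp
  · obtain rfl : n = 1 := le_antisymm h hn
    have : IsEmpty {l : Nat.Partition 1 // ((1 : ℕ) : ℚ) / 2 ≤ (l.rank : ℚ)} := by
      refine ⟨fun l ↦ ?_⟩
      have h1 := (half_le_rank_iff l.1).mp l.2
      have h2 : l.1.parts.sup ≤ 1 := Multiset.sup_le.mpr fun b hb ↦
        (Multiset.le_sum_of_mem hb).trans l.1.parts_sum.le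
      have h3 : l.1.parts = 0 := by
        rw [← Multiset.card_eq_zero]
        omega
      have h4 := l.1.parts_sum
      rw [h3] at h4
      simp at h4
    rw [Nat.card_of_isEmpty, partitionFn]
    norm_num

end LargeRank

section Ratio

lemma partitionGrowth_pos {n : ℕ} (hn : 0 < n) : 0 < partitionGrowth n := by
  have : (0 : ℝ) < n := by exact_mod_cast hn
  unfold partitionGrowth
  positivity

lemma tendsto_half_div : Tendsto (fun n : ℕ ↦ ((n / 2 - 1 : ℕ) : ℝ) / n) atTop (𝓝 (1 / 2)) := by
  have h : ∀ᶠ n : ℕ in atTop, 1 / 2 - 2 * (n : ℝ)⁻¹ ≤ ((n / 2 - 1 : ℕ) : ℝ) / n := by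
    filter_upwards [eventually_ge_atTop 2] with n hn
    have hn0 : (0 : ℝ) < n := by exact_mod_cast (by omega : 0 < n)
    have : n ≤ 2 * (n / 2 - 1) + 4 := by omega
    have : (n : ℝ) ≤ 2 * ((n / 2 - 1 : ℕ) : ℝ) + 4 := by exact_mod_cast this
    rw [le_div_iff₀ hn0, sub_mul, mul_assoc, inv_mul_cancel₀ hn0.ne']
    linarith
  have h' : ∀ᶠ n : ℕ in atTop, ((n / 2 - 1 : ℕ) : ℝ) / n ≤ 1 / 2 := by
    filter_upwards [eventually_ge_atTop 2] with n hn
    have hn0 : (0 : ℝ) < n := by exact_mod_cast (by omega : 0 < n)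
    have : 2 * (n / 2 - 1) ≤ n := by omega
    have : 2 * ((n / 2 - 1 : ℕ) : ℝ) ≤ (n : ℝ) := by exact_mod_cast this
    rw [div_le_iff₀ hn0]
    linarith
  refine tendsto_of_tendsto_of_tendsto_of_le_of_le' ?_ tendsto_const_nhds h h'
  have := (tendsto_inv_atTop_zero.comp (tendsto_natCast_atTop_atTop (R := ℝ))).const_mul (2 : ℝ)
  simpa using tendsto_const_nhds (x := (1 / 2 : ℝ)) |>.sub this

lemma tendsto_sqrt_two_mul_half_sub :
    Tendsto (fun n : ℕ ↦ √2 * √((n / 2 - 1 : ℕ) / 3) - √((n : ℝ) / 3)) atTop (𝓝 0) := by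
  have hlim : Tendsto (fun n : ℕ ↦ 2 * (√((n : ℝ) / 3))⁻¹) atTop (𝓝 0) := by
    have h1 : Tendsto (fun n : ℕ ↦ √((n : ℝ) / 3)) atTop atTop :=
      Real.tendsto_sqrt_atTop.comp (tendsto_natCast_atTop_atTop.atTop_div_const (by norm_num))
    simpa using (tendsto_inv_atTop_zero.comp h1).const_mul 2
  refine squeeze_zero_norm' ?_ hlim
  filter_upwards [eventually_ge_atTop 2] with n hn
  have hn0 : (0 : ℝ) < n := by exact_mod_cast (by omega : 0 < n)
  set m : ℝ := ((n / 2 - 1 : ℕ) : ℝ) with hm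
  have hm0 : 0 ≤ m := Nat.cast_nonneg _
  have hle1 : (n : ℝ) ≤ 2 * m + 4 := by
    have : n ≤ 2 * (n / 2 - 1) + 4 := by omega
    rw [hm]
    exact_mod_cast this
  have hle2 : 2 * m ≤ n := by
    have : 2 * (n / 2 - 1) ≤ n := by omega
    rw [hm]
    exact_mod_cast this
  rw [← Real.sqrt_mul (by norm_num)]
  set a := √(2 * (m / 3)) with ha
  set b := √((n : ℝ) / 3) with hb
  have hb0 : 0 < b := by positivity
  have ha0 : 0 ≤ a := Real.sqrt_nonneg _
  have hasq : a ^ 2 = 2 * (m / 3) := Real.sq_sqrt (by positivity)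
  have hbsq : b ^ 2 = n / 3 := Real.sq_sqrt (by positivity)
  have hab : a ≤ b := Real.sqrt_le_sqrt (by linarith)
  rw [Real.norm_eq_abs, abs_sub_comm, abs_of_nonneg (by linarith), ← div_eq_mul_inv,
    le_div_iff₀ hb0]
  nlinarith

lemma tendsto_partitionGrowth_ratio :
    Tendsto (fun n : ℕ ↦ partitionGrowth (n / 2 - 1) / partitionGrowth n /
      (2 * Real.exp (Real.pi * (1 - √2) * √((n : ℝ) / 3)))) atTop (𝓝 1) := by
  have h1 := (tendsto_half_div.inv₀ (by norm_num)).const_mul (1 / 2)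
  have h2 := (tendsto_sqrt_two_mul_half_sub.const_mul Real.pi).rexp
  have h3 := h1.mul h2
  rw [mul_zero, Real.exp_zero, mul_one, mul_inv_cancel₀ (by norm_num)] at h3
  refine h3.congr' ?_
  filter_upwards [eventually_ge_atTop 4] with n hn
  have hn0 : (0 : ℝ) < n := by exact_mod_cast (by omega : 0 < n)
  have hm0 : (0 : ℝ) < ((n / 2 - 1 : ℕ) : ℝ) := by exact_mod_cast (by omega : 0 < n / 2 - 1)
  have hexp : Real.exp (Real.pi * (√2 * √((n / 2 - 1 : ℕ) / 3) - √((n : ℝ) / 3))) =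
      Real.exp (Real.pi * √2 * √((n / 2 - 1 : ℕ) / 3)) /
        (Real.exp (Real.pi * √2 * √(n / 3)) *
          Real.exp (Real.pi * (1 - √2) * √((n : ℝ) / 3))) := by
    rw [← Real.exp_add, ← Real.exp_sub]
    congr 1
    ring
  simp only [partitionGrowth]
  rw [hexp]
  field_simp

lemma tendsto_card_partition_ratio :
    Tendsto (fun n : ℕ ↦ (Nat.card (Nat.Partition (n / 2 - 1)) : ℝ) / Nat.card n.Partition /
      (2 * Real.exp (Real.pi * (1 - √2) * √((n : ℝ) / 3)))) atTop (𝓝 1) := by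
  obtain ⟨L, hL, hlim⟩ := exists_tendsto_card_partition_div
  have hhalf : Tendsto (fun n : ℕ ↦ n / 2 - 1) atTop atTop :=
    tendsto_atTop_mono (fun n ↦ by omega : ∀ n : ℕ, (n - 2) / 2 ≤ n / 2 - 1)
      ((Nat.tendsto_div_const_atTop two_ne_zero).comp (tendsto_sub_atTop_nat 2))
  have h := ((hlim.comp hhalf).div hlim hL).mul tendsto_partitionGrowth_ratio
  rw [div_self hL, one_mul] at h
  refine h.congr' ?_
  filter_upwards [eventually_ge_atTop 4] with n hn
  have h1 := partitionGrowth_pos (by omega : 0 < n)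
  have h2 := partitionGrowth_pos (by omega : 0 < n / 2 - 1)
  have h3 : (0 : ℝ) < Nat.card n.Partition := by exact_mod_cast Nat.card_pos
  simp only [Function.comp_apply, Pi.div_apply]
  field_simp

end Ratio

end PartitionAsymptotics

open Filter Real in
theorem proportion_large_rank_asymptotic :
    (∀ n : ℕ, 1 ≤ n →
      ((Nat.card {l : Nat.Partition n // (n : ℚ) / 2 ≤ (l.rank : ℚ)} : ℝ)
          / (partitionFn n : ℝ))
        = (partitionFn (⌊(n : ℚ) / 2⌋ - 1) : ℝ) / (partitionFn n : ℝ)) ∧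
      Tendsto
        (fun n : ℕ =>
          ((Nat.card {l : Nat.Partition n // (n : ℚ) / 2 ≤ (l.rank : ℚ)} : ℝ)
              / (partitionFn n : ℝ))
            / (2 * Real.exp (Real.pi * (1 - Real.sqrt 2) * Real.sqrt ((n : ℝ) / 3))))
        atTop (nhds 1) := by
  refine ⟨fun n hn ↦ by rw [PartitionAsymptotics.card_large_rank hn], ?_⟩
  refine PartitionAsymptotics.tendsto_card_partition_ratio.congr' ?_
  filter_upwards [eventually_ge_atTop 2] with n hn
  rw [PartitionAsymptotics.card_large_rank_of_eq (by omega : n / 2 - 1 + 1 = n / 2)]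
  simp [partitionFn]
end
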